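/- arXiv:1602.02318 — 2 statements merged into one kernel-verified Lean document; each statement's English description precedes it below -/
import Mathlib

section
/- Let S be a connected maximal m-rigid set of (m+1)-diagonals of P_{n,m} (hence, by Lemma 2.4 of the paper, pairwise noncrossing). Then every tile of S has one of the following types: (k, m+k−1) for some 1 ≤ k ≤ m+1; (m+2, 2m+1) with at least one outer-diagonal short; (1, 2m+1); (m+3, m+1) with both outer-diagonals short; or (m+3, 0). -/
namespace PaperTiling

variable {M : ℕ}

/-- `[i,j]`: the number of vertices encountered travelling clockwise from `i` to `j`, inclusive. -/
def cnt (i j : ZMod M) : ℕ := (j - i).val + 1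

/-- `C(v₁,…,v_r)`: the entries are pairwise distinct and occur in this clockwise cyclic order. -/
def CW (l : List (ZMod M)) : Prop :=
  l.Nodup ∧ ((l.zip (l.rotate 1)).map fun p => (p.2 - p.1).val).sum = M

/-- Two diagonals cross. -/
def Crosses (d e : Sym2 (ZMod M)) : Prop :=
  ∃ a1 b1 a2 b2 : ZMod M, d = s(a1, a2) ∧ e = s(b1, b2) ∧ CW [a1, b1, a2, b2]

/-- `d` is an `(m+1)`-diagonal. -/
def IsMDiag (m : ℕ) (d : Sym2 (ZMod M)) : Prop :=
  ¬ d.IsDiag ∧ ∀ i j : ZMod M, d = s(i, j) → (m + 1) ∣ cnt i j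

/-- Short diagonal. -/
def IsShort (m : ℕ) (d : Sym2 (ZMod M)) : Prop :=
  ∃ v : ZMod M, d = s(v, v + (m : ZMod M))

/-- Long diagonal. -/
def IsLong (m : ℕ) (d : Sym2 (ZMod M)) : Prop := IsMDiag m d ∧ ¬ IsShort m d

/-- The shift `Σ^k`. -/
def shiftD (k : ℕ) (d : Sym2 (ZMod M)) : Sym2 (ZMod M) :=
  d.map (fun v => v + (k : ZMod M))

/-- `a` and `b` are `k`-neighbours. -/
def Nbr (k : ℕ) (a b : Sym2 (ZMod M)) : Prop :=
  a ≠ b ∧ ¬ Crosses a b ∧ ∃ v ∈ a, ((v + (k : ZMod M)) ∈ b ∨ (v - (k : ZMod M)) ∈ b)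

/-- The Ext-hammock condition `E_k(b,a)`. -/
def Ek (m k : ℕ) (b a : Sym2 (ZMod M)) : Prop :=
  (Nbr k a b ∧ ∃ v ∈ a, (v + (k : ZMod M)) ∈ b) ∨
  (∃ a1 b1 a2 b2 : ZMod M, a = s(a1, a2) ∧ b = s(b1, b2) ∧ CW [a1, b1, a2, b2] ∧
    (∃ x : ℕ, 1 ≤ x ∧ cnt a1 b1 = x * (m + 1) + k) ∧
    (∃ x : ℕ, 1 ≤ x ∧ cnt a2 b2 = x * (m + 1) + k)) ∨
  b = shiftD k a

/-- `S` is `m`-rigid. -/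
def MRigid (m : ℕ) (S : Set (Sym2 (ZMod M))) : Prop :=
  ∀ a ∈ S, ∀ b ∈ S, ∀ k : ℕ, 1 ≤ k → k ≤ m → ¬ Ek m k b a

/-- `S` is maximal `m`-rigid (among sets of `(m+1)`-diagonals). -/
def MaxMRigid (m : ℕ) (S : Set (Sym2 (ZMod M))) : Prop :=
  (∀ d ∈ S, IsMDiag m d) ∧ MRigid m S ∧
  ∀ d : Sym2 (ZMod M), IsMDiag m d → d ∉ S → ¬ MRigid m (insert d S)

/-- `v` lies on no diagonal of `S`. -/
def Isolated (S : Set (Sym2 (ZMod M))) (v : ZMod M) : Prop := ∀ d ∈ S, v ∉ d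

/-- The graph of `S`. -/
def graphOf (S : Set (Sym2 (ZMod M))) : SimpleGraph (ZMod M) := SimpleGraph.fromEdgeSet S

/-- The induced subgraph of the graph of `S` on non-isolated vertices is connected. -/
def ConnectedSet (S : Set (Sym2 (ZMod M))) : Prop :=
  ((graphOf S).induce {v : ZMod M | ¬ Isolated S v}).Connected

/-- A tiling: a set of pairwise noncrossing diagonals. -/
def IsTiling (S : Set (Sym2 (ZMod M))) : Prop :=
  (∀ d ∈ S, ¬ d.IsDiag) ∧ ∀ d ∈ S, ∀ e ∈ S, ¬ Crosses d e

/-- The tile of `S` adjacent to the diagonal `{a,b}` on the side of the clockwise arc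
from `a` to `b`. -/
def tileAt (S : Set (Sym2 (ZMod M))) (a b : ZMod M) : Set (ZMod M) :=
  {v | cnt a v ≤ cnt a b ∧
    ∀ c e : ZMod M, s(c, e) ∈ S → s(c, e) ≠ s(a, b) →
      cnt a c ≤ cnt a e → cnt a e ≤ cnt a b →
      ¬ (cnt a c < cnt a v ∧ cnt a v < cnt a e)}

def IsTile (S : Set (Sym2 (ZMod M))) (T : Set (ZMod M)) : Prop :=
  ∃ a b : ZMod M, s(a, b) ∈ S ∧ T = tileAt S a b

/-- `d` is a bounding diagonal of the tile `T`. -/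
def IsBounding (S : Set (Sym2 (ZMod M))) (T : Set (ZMod M)) (d : Sym2 (ZMod M)) : Prop :=
  d ∈ S ∧ ∀ v ∈ d, v ∈ T

/-- The length `ℓ(T)` of a tile: the number of its bounding diagonals. -/
noncomputable def tileLen (S : Set (Sym2 (ZMod M))) (T : Set (ZMod M)) : ℕ :=
  {d | IsBounding S T d}.ncard

/-- `v` is strictly clockwise between `p` and `q`. -/
def StrictIn (p q v : ZMod M) : Prop := 1 < cnt p v ∧ cnt p v < cnt p q

/-- `(p,q)` is an open boundary of the tile `T`. -/
def IsOpenBdry (S : Set (Sym2 (ZMod M))) (T : Set (ZMod M)) (p q : ZMod M) : Prop :=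
  p ≠ q ∧ p ∈ T ∧ q ∈ T ∧
  (∃ d, IsBounding S T d ∧ p ∈ d) ∧ (∃ d, IsBounding S T d ∧ q ∈ d) ∧
  (∀ v : ZMod M, StrictIn p q v → v ∈ T ∧ Isolated S v) ∧
  (∀ d, IsBounding S T d → d ≠ s(p, q) → ∀ v ∈ d, ¬ StrictIn p q v)

def IsOpenTile (S : Set (Sym2 (ZMod M))) (T : Set (ZMod M)) : Prop :=
  ∃ p q, IsOpenBdry S T p q

/-- Tile of type `(ℓ, b)` with `b ≥ 1`. -/
def HasOpenType (S : Set (Sym2 (ZMod M))) (T : Set (ZMod M)) (l b : ℕ) : Prop :=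
  tileLen S T = l ∧ ∃ p q, IsOpenBdry S T p q ∧ cnt p q - 1 = b

/-- Tile of type `(ℓ, 0)`. -/
def HasClosedType (S : Set (Sym2 (ZMod M))) (T : Set (ZMod M)) (l : ℕ) : Prop :=
  tileLen S T = l ∧ ¬ IsOpenTile S T

/-- The list of possible tile types from Proposition 2.9. -/
def GoodTiles (m : ℕ) (S : Set (Sym2 (ZMod M))) : Prop :=
  ∀ T : Set (ZMod M), IsTile S T →
    (∃ k, 1 ≤ k ∧ k ≤ m + 1 ∧ HasOpenType S T k (m + k - 1)) ∨
    (tileLen S T = m + 2 ∧ ∃ p q, IsOpenBdry S T p q ∧ cnt p q - 1 = 2 * m + 1 ∧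
      ∃ d, IsBounding S T d ∧ (p ∈ d ∨ q ∈ d) ∧ IsShort m d) ∨
    HasOpenType S T 1 (2 * m + 1) ∨
    (tileLen S T = m + 3 ∧ ∃ p q, IsOpenBdry S T p q ∧ cnt p q - 1 = m + 1 ∧
      ∀ d, IsBounding S T d → (p ∈ d ∨ q ∈ d) → IsShort m d) ∨
    HasClosedType S T (m + 3)

/-- A quiver (arrow relation) with a set of length-two relation paths. -/
structure GPair (V : Type) where
  Arr : V → V → Prop
  Rel : V → V → V → Prop

namespace GPair

variable {V : Type} (G : GPair V)

def IsGentle : Prop :=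
  (∀ x y z, G.Rel x y z → G.Arr x y ∧ G.Arr y z) ∧
  (∀ x, ¬ G.Arr x x) ∧
  (∀ x y, G.Arr x y → ¬ G.Arr y x) ∧
  (∀ x, {y | G.Arr x y}.encard ≤ 2) ∧
  (∀ x, {y | G.Arr y x}.encard ≤ 2) ∧
  (∀ x y, G.Arr x y → {z | G.Arr y z ∧ ¬ G.Rel x y z}.encard ≤ 1) ∧
  (∀ x y, G.Arr x y → {w | G.Arr w x ∧ ¬ G.Rel w x y}.encard ≤ 1) ∧
  (∀ x y, G.Arr x y → {z | G.Arr y z ∧ G.Rel x y z}.encard ≤ 1) ∧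
  (∀ x y, G.Arr x y → {w | G.Arr w x ∧ G.Rel w x y}.encard ≤ 1)

/-- The underlying undirected graph is connected. -/
def Conn : Prop := (SimpleGraph.fromRel G.Arr).Connected

def OrientedCycle (r : ℕ) (v : ZMod r → V) : Prop :=
  3 ≤ r ∧ Function.Injective v ∧ ∀ i : ZMod r, G.Arr (v i) (v (i + 1))

def UndirCycle (r : ℕ) (v : ZMod r → V) : Prop :=
  3 ≤ r ∧ Function.Injective v ∧ ∀ i : ZMod r, G.Arr (v i) (v (i + 1)) ∨ G.Arr (v (i + 1)) (v i)

/-- All cycles are oriented and relation-full. -/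
def CyclesOrientedFull : Prop :=
  (∀ (r : ℕ) (v : ZMod r → V), G.UndirCycle r v →
    (∀ i, G.Arr (v i) (v (i + 1))) ∨ ∀ i, G.Arr (v (i + 1)) (v i)) ∧
  ∀ (r : ℕ) (v : ZMod r → V), G.OrientedCycle r v →
    ∀ i : ZMod r, G.Rel (v i) (v (i + 1)) (v (i + 2))

/-- The valency of a vertex: the number of arrows incident with it. -/
noncomputable def valency (x : V) : ℕ∞ := {y | G.Arr x y}.encard + {y | G.Arr y x}.encard

/-- A (non-trivial) permitted path, recorded by its list of vertices. -/
def PermPath (l : List V) : Prop :=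
  2 ≤ l.length ∧ l.Chain' G.Arr ∧ ∀ x y z : V, [x, y, z] <:+: l → ¬ G.Rel x y z

/-- A (non-trivial) forbidden path, recorded by its list of vertices. -/
def ForbPath (l : List V) : Prop :=
  2 ≤ l.length ∧ l.Chain' G.Arr ∧ (l.zip l.tail).Nodup ∧
    ∀ x y z : V, [x, y, z] <:+: l → G.Rel x y z

def TrivPermVtx (v : V) : Prop :=
  {y | G.Arr v y}.Subsingleton ∧ {y | G.Arr y v}.Subsingleton ∧
  ∀ x y, G.Arr x v → G.Arr v y → ¬ G.Rel x v y

def TrivForbVtx (v : V) : Prop :=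
  {y | G.Arr v y}.Subsingleton ∧ {y | G.Arr y v}.Subsingleton ∧
  ∀ x y, G.Arr x v → G.Arr v y → G.Rel x v y

/-- A permitted thread: a maximal permitted path, or a trivial permitted thread `[v]`. -/
def PermThread (l : List V) : Prop :=
  (G.PermPath l ∧ (∀ w, ¬ G.PermPath (l ++ [w])) ∧ ∀ w, ¬ G.PermPath (w :: l)) ∨
  ∃ v, l = [v] ∧ G.TrivPermVtx v

/-- A forbidden thread: a maximal forbidden path, or a trivial forbidden thread `[v]`. -/
def ForbThread (l : List V) : Prop :=
  (G.ForbPath l ∧ (∀ w, ¬ G.ForbPath (l ++ [w])) ∧ ∀ w, ¬ G.ForbPath (w :: l)) ∨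
  ∃ v, l = [v] ∧ G.TrivForbVtx v

end GPair

/-- A thread is closed if it is a cycle. -/
def IsClosedList {V : Type} (l : List V) : Prop := 2 ≤ l.length ∧ l.head? = l.getLast?

/-- The length (number of arrows) of a thread. -/
def threadLen {V : Type} (l : List V) : ℕ := l.length - 1

/-- Number of occurrences of the vertex `v` along the thread `l`. -/
def occ {V : Type} [DecidableEq V] (l : List V) (v : V) : ℕ :=
  if 2 ≤ l.length ∧ l.head? = l.getLast? then l.dropLast.count v else l.count v

/-- Arrow of the tiling quiver arising from the tile `T`. -/
def QArrIn (S : Set (Sym2 (ZMod M))) (T : Set (ZMod M)) (α β : Sym2 (ZMod M)) : Prop :=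
  IsTile S T ∧ IsBounding S T α ∧ IsBounding S T β ∧
  ∃ x a b : ZMod M, α = s(x, a) ∧ β = s(x, b) ∧ cnt x a < cnt x b

def QArr (S : Set (Sym2 (ZMod M))) (α β : Sym2 (ZMod M)) : Prop := ∃ T, QArrIn S T α β

def QRel (S : Set (Sym2 (ZMod M))) (α β γ : Sym2 (ZMod M)) : Prop :=
  ∃ T, QArrIn S T α β ∧ QArrIn S T β γ

/-- The tiling-algebra pair `(Q_S, R_S)` of a tiling `S`. -/
def tilingPair (S : Set (Sym2 (ZMod M))) : GPair {d : Sym2 (ZMod M) // d ∈ S} where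
  Arr := fun α β => QArr S α.1 β.1
  Rel := fun α β γ => QRel S α.1 β.1 γ.1

/-- Isomorphism of pairs. -/
def GPair.Iso {V W : Type} (G : GPair V) (H : GPair W) : Prop :=
  ∃ e : V ≃ W, (∀ x y, G.Arr x y ↔ H.Arr (e x) (e y)) ∧
    ∀ x y z, G.Rel x y z ↔ H.Rel (e x) (e y) (e z)

/-- `l` is the fan at the marked point `v`: the list of all diagonals of `S` incident with
`v`, in clockwise order around `v`. -/
def IsFan (S : Set (Sym2 (ZMod M))) (v : ZMod M) (l : List {d : Sym2 (ZMod M) // d ∈ S}) :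
    Prop :=
  l.Nodup ∧ (∀ d : {d : Sym2 (ZMod M) // d ∈ S}, d ∈ l ↔ v ∈ d.1) ∧
  l.Pairwise fun d e => ∃ a b : ZMod M, d.1 = s(v, a) ∧ e.1 = s(v, b) ∧ cnt v a < cnt v b

/-- `F` is the forbidden thread ending at `t(H)` from the opposite direction to `H`. -/
def OppEnd {V : Type} (G : GPair V) (H F : List V) : Prop :=
  ∃ y : V, H.getLast? = some y ∧ F.getLast? = some y ∧
    ((∃ x w, [x, y] <:+ H ∧ [w, y] <:+ F ∧ x ≠ w) ∨
     (∃ w, [w, y] <:+ F ∧ (∀ u, G.Arr u y → u = w) ∧ ¬ ([w, y] <:+: H)) ∨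
     (F = [y] ∧ {u | G.Arr u y}.Subsingleton ∧ ∀ u, G.Arr u y → [u, y] <:+: H))

/-- `H` is the permitted thread starting at `s(F)` in the opposite direction to `F`. -/
def OppStart {V : Type} (G : GPair V) (F H : List V) : Prop :=
  ∃ y : V, F.head? = some y ∧ H.head? = some y ∧
    ((∃ x w, [y, x] <+: F ∧ [y, w] <+: H ∧ x ≠ w) ∨
     (∃ w, [y, w] <+: H ∧ (∀ u, G.Arr y u → u = w) ∧ ¬ ([y, w] <:+: F)) ∨
     (H = [y] ∧ {u | G.Arr y u}.Subsingleton ∧ ∀ u, G.Arr y u → [y, u] <:+: F))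

/-- The AG-successor relation on permitted threads. -/
def AGStep {V : Type} (G : GPair V) (H H' : List V) : Prop :=
  ∃ F, G.ForbThread F ∧ OppEnd G H F ∧ OppStart G F H'

/-- The sides of a tile: bounding diagonals together with boundary edges. -/
def sides (S : Set (Sym2 (ZMod M))) (T : Set (ZMod M)) : Set (Sym2 (ZMod M)) :=
  {d | IsBounding S T d} ∪ {d | ∃ v : ZMod M, d = s(v, v + 1) ∧ v ∈ T ∧ (v + 1) ∈ T}

/-- An `(m+3)`-angulation of a disc. -/
def IsAngulation (m : ℕ) (S : Set (Sym2 (ZMod M))) : Prop :=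
  IsTiling S ∧ (∀ v : ZMod M, s(v, v + 1) ∉ S) ∧
  ∀ T, IsTile S T → (sides S T).ncard = m + 3

namespace Core

/-- circular distance larger than `m`, or equal -/
def Far (m N x z : ℕ) : Prop :=
  (z < x → m < x - z ∧ x - z + m < N) ∧ (x < z → m < z - x ∧ z - x + m < N)

structure Hyp (m N B : ℕ) (R : ℕ → ℕ → Prop) : Prop where
  lt : ∀ {x y}, R x y → x < N
  symm : ∀ {x y}, R x y → R y x
  ne : ∀ {x y}, R x y → x ≠ y
  dvd : ∀ {x y}, R x y → x < y → (m + 1) ∣ y - x + 1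
  nc : ∀ {x y z w}, R x y → R z w → x < z → z < y → y < w → False
  far : ∀ {x y z w}, R x y → R z w → Far m N x z
  max : ∀ x y, x < y → y < N → (m + 1) ∣ y - x + 1 →
    (∀ z w, R z w → x < z → z < y → y < w → False) →
    (∀ z w, R z w → z < x → x < w → w < y → False) →
    (∀ z w, R z w → Far m N x z) → (∀ z w, R z w → Far m N y z) → R x y
  conn : ∀ W : Set ℕ, (∀ x y, R x y → x ∈ W → y ∈ W) →
    ∀ x y, R x y → x ∈ W → ∀ z w, R z w → z ∈ W
  base : R 0 B
  pos : 0 < B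

def Tau (B : ℕ) (R : ℕ → ℕ → Prop) (x : ℕ) : Prop :=
  x ≤ B ∧ ∀ c e, R c e → e ≤ B → ¬ (c = 0 ∧ e = B) → c < x → x < e → False

def Step (B : ℕ) (R : ℕ → ℕ → Prop) (x y : ℕ) : Prop :=
  x < y ∧ R x y ∧ Tau B R x ∧ Tau B R y ∧ ¬ (x = 0 ∧ y = B)

variable {m N B : ℕ} {R : ℕ → ℕ → Prop}

lemma tau_zero : Tau B R 0 := ⟨Nat.zero_le _, fun _ _ _ _ _ h => by omega⟩

lemma tau_B : Tau B R B := ⟨le_rfl, fun _ _ _ _ _ _ h => by omega⟩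

lemma Hyp.chord (H : Hyp m N B R) {x y : ℕ} (hx : Tau B R x) (hy : Tau B R y) (hxy : x < y)
    (hd : (m + 1) ∣ y - x + 1) (fx : ∀ z w, R z w → Far m N x z)
    (fy : ∀ z w, R z w → Far m N y z) : R x y := by
  have hBN := H.lt (H.symm H.base)
  have := hx.1
  have := hy.1
  refine H.max x y hxy (by omega) hd ?_ ?_ fx fy
  · intro z w h h1 h2 h3
    by_cases hw : w ≤ B
    · exact hy.2 z w h hw (by omega) h2 h3
    · exact H.nc H.base h (by omega) (by omega) (by omega)
  · intro z w h h1 h2 h3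
    exact hx.2 z w h (by omega) (by omega) h1 h2

/-- chord between nonisolated vertices -/
lemma Hyp.chord' (H : Hyp m N B R) {x y : ℕ} (hx : Tau B R x) (hy : Tau B R y) (hxy : x < y)
    (hd : (m + 1) ∣ y - x + 1) (ix : ∃ z, R x z) (iy : ∃ z, R y z)
    (hne : ¬ (x = 0 ∧ y = B)) : Step B R x y := by
  obtain ⟨z, hz⟩ := ix
  obtain ⟨w, hw⟩ := iy
  exact ⟨hxy, H.chord hx hy hxy hd (fun _ _ h => H.far hz h) (fun _ _ h => H.far hw h), hx, hy, hne⟩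

lemma step_unique {x y z : ℕ} (h : Step B R x y) (h' : Step B R x z) : y = z := by
  by_contra hne
  rcases lt_or_gt_of_ne hne with hl | hl
  · exact h.2.2.2.1.2 x z h'.2.1 h'.2.2.2.1.1 h'.2.2.2.2 h.1 hl
  · exact h'.2.2.2.1.2 x y h.2.1 h.2.2.2.1.1 h.2.2.2.2 h'.1 hl

lemma Hyp.no_step (H : Hyp m N B R) {x : ℕ} (hx : Tau B R x) (hn : ∀ y, ¬ Step B R x y) :
    ∀ y, R x y → x < y → y ≤ B → (x = 0 ∧ y = B) := by
  classical
  intro y hy hxy hyB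
  by_contra hne
  -- take the largest such y
  obtain ⟨M, hM, hmax⟩ : ∃ M, (R x M ∧ x < M ∧ M ≤ B ∧ ¬ (x = 0 ∧ M = B)) ∧
      ∀ z, (R x z ∧ x < z ∧ z ≤ B ∧ ¬ (x = 0 ∧ z = B)) → z ≤ M := by
    have hfin : {z | R x z ∧ x < z ∧ z ≤ B ∧ ¬ (x = 0 ∧ z = B)}.Finite :=
      (Set.finite_Iic B).subset (fun z hz => hz.2.2.1)
    obtain ⟨M, hM, h⟩ := Set.exists_max_image _ id hfin ⟨y, hy, hxy, hyB, hne⟩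
    exact ⟨M, hM, fun z hz => h z hz⟩
  obtain ⟨h1, h2, h3, h4⟩ := hM
  refine hn M ⟨h2, h1, hx, ⟨h3, ?_⟩, h4⟩
  intro c e hce heB hne' hcM hMe
  rcases lt_trichotomy c x with h | h | h
  · exact hx.2 c e hce heB hne' h (by omega)
  · subst h
    have := hmax e ⟨hce, by omega, heB, hne'⟩
    omega
  · exact H.nc h1 hce h hcM hMe

lemma Hyp.unit (H : Hyp m N B R) {x : ℕ} (hx : Tau B R x) (hn : ∀ y, ¬ Step B R x y)
    (hxB : x < B) : Tau B R (x + 1) := by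
  refine ⟨hxB, fun c e hce heB hne h1 h2 => ?_⟩
  rcases lt_or_ge c x with h | h
  · exact hx.2 c e hce heB hne h (by omega)
  · have : c = x := by omega
    subst this
    exact hne (H.no_step hx hn e hce (by omega) heB)

/-- a maximal run of diagonal steps -/
structure Run (m B : ℕ) (R : ℕ → ℕ → Prop) (x r : ℕ) (t : ℕ → ℕ) : Prop where
  zero : t 0 = x
  step : ∀ i < r, Step B R (t i) (t (i + 1))
  last : Tau B R (t r)
  halt : ∀ y, ¬ Step B R (t r) y

lemma exists_run : ∀ k x : ℕ, B - x ≤ k → Tau B R x → ∃ r t, Run m B R x r t := by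
  intro k
  induction k with
  | zero =>
    intro x hk hx
    refine ⟨0, fun _ => x, rfl, by simp, hx, fun y hy => ?_⟩
    have := hy.1
    have := hy.2.2.2.1.1
    omega
  | succ k ih =>
    intro x hk hx
    by_cases h : ∃ y, Step B R x y
    · obtain ⟨y, hy⟩ := h
      have h1 := hy.1
      have h2 := hy.2.2.2.1.1
      obtain ⟨r, t, ht⟩ := ih y (by omega) hy.2.2.2.1
      refine ⟨r + 1, fun i => if i = 0 then x else t (i - 1), rfl, ?_, ?_, ?_⟩
      · intro i hi
        rcases i with _ | i
        · simpa [ht.zero] using hy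
        · simpa using ht.step i (by omega)
      · simpa using ht.last
      · simpa using ht.halt
    · exact ⟨0, fun _ => x, rfl, by simp, hx, fun y hy => h ⟨y, hy⟩⟩

variable {x r : ℕ} {t : ℕ → ℕ}

lemma Run.tau (T : Run m B R x r t) {i : ℕ} (hi : i ≤ r) : Tau B R (t i) := by
  rcases hi.lt_or_eq with h | h
  · exact (T.step i h).2.2.1
  · exact h ▸ T.last

lemma Run.mono (T : Run m B R x r t) {j : ℕ} (hj : j ≤ r) : ∀ i < j, t i < t j := by
  induction j with
  | zero => intro i hi; omega
  | succ j ih =>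
    intro i hi
    have h1 := (T.step j (by omega)).1
    rcases Nat.lt_succ_iff_lt_or_eq.1 hi with h | h
    · exact (ih (by omega) i h).trans h1
    · exact h ▸ h1

lemma Run.inj (T : Run m B R x r t) {i j : ℕ} (hi : i ≤ r) (hj : j ≤ r) (h : t i = t j) :
    i = j := by
  rcases lt_trichotomy i j with h' | h' | h'
  · have := T.mono hj i h'; omega
  · exact h'
  · have := T.mono hi j h'; omega

lemma Run.nonIso (H : Hyp m N B R) (T : Run m B R x r t) (hx : ∃ y, R x y) {i : ℕ} (hi : i ≤ r) :
    ∃ y, R (t i) y := by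
  rcases i with _ | i
  · rwa [T.zero]
  · exact ⟨_, H.symm (T.step i (by omega)).2.1⟩

lemma Run.cong (H : Hyp m N B R) (T : Run m B R x r t) {i : ℕ} (hi : i ≤ r) :
    ∃ c, t i + i = x + (m + 1) * c := by
  induction i with
  | zero => exact ⟨0, by simp [T.zero]⟩
  | succ i ih =>
    obtain ⟨c, hc⟩ := ih (by omega)
    have hs := T.step i (by omega)
    obtain ⟨d, hd⟩ := H.dvd hs.2.1 hs.1
    have := hs.1
    refine ⟨c + d, ?_⟩
    rw [mul_add]
    omega

lemma Run.find (T : Run m B R x r t) {y : ℕ} (hy : Tau B R y) (hxy : x ≤ y) {j : ℕ} (hj : j ≤ r) :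
    y ≤ t j → ∃ i ≤ j, t i = y := by
  induction j with
  | zero => intro h; exact ⟨0, le_rfl, by have := T.zero; omega⟩
  | succ j ih =>
    intro h
    by_cases h1 : y ≤ t j
    · obtain ⟨i, hi, h⟩ := ih (by omega) h1
      exact ⟨i, by omega, h⟩
    · by_cases h2 : y = t (j + 1)
      · exact ⟨j + 1, le_rfl, h2.symm⟩
      · have hs := T.step j (by omega)
        exact (hy.2 _ _ hs.2.1 hs.2.2.2.1.1 hs.2.2.2.2 (by omega) (by omega)).elim

/-- the bounding pairs of a run -/
def Run.pairs (_ : Run m B R x r t) : Finset (ℕ × ℕ) :=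
  (Finset.range r).image (fun i => (t i, t (i + 1)))

lemma Run.card_pairs (T : Run m B R x r t) : T.pairs.card = r := by
  rw [Run.pairs, Finset.card_image_of_injOn, Finset.card_range]
  intro i hi j hj h
  simp only [Finset.coe_range, Set.mem_Iio] at hi hj
  exact T.inj (by omega) (by omega) (Prod.ext_iff.1 h).1

lemma Run.mem_pairs (T : Run m B R x r t) {c e : ℕ} (hx : x ≤ c) (hr : c ≤ t r) :
    (c, e) ∈ T.pairs ↔ Step B R c e := by
  simp only [Run.pairs, Finset.mem_image, Finset.mem_range, Prod.mk.injEq]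
  constructor
  · rintro ⟨i, hi, rfl, rfl⟩
    exact T.step i hi
  · intro h
    obtain ⟨i, hi, rfl⟩ := T.find h.2.2.1 hx le_rfl hr
    rcases hi.lt_or_eq with h' | h'
    · exact ⟨i, h', rfl, step_unique (T.step i h') h⟩
    · subst h'
      exact (T.halt e h).elim

lemma Run.pairs_bound (T : Run m B R x r t) {c e : ℕ} (h : (c, e) ∈ T.pairs) :
    x ≤ c ∧ c < t r := by
  simp only [Run.pairs, Finset.mem_image, Finset.mem_range, Prod.mk.injEq] at h
  obtain ⟨i, hi, rfl, rfl⟩ := h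
  refine ⟨?_, T.mono le_rfl i hi⟩
  rcases i with _ | i
  · exact T.zero.ge
  · have := T.mono hi.le 0 (by omega)
    have := T.zero
    omega

lemma bd_iff (H : Hyp m N B R) (c e : ℕ) : (c < e ∧ R c e ∧ Tau B R c ∧ Tau B R e) ↔
    (c = 0 ∧ e = B) ∨ Step B R c e := by
  constructor
  · rintro ⟨h1, h2, h3, h4⟩
    by_cases h : c = 0 ∧ e = B
    · exact Or.inl h
    · exact Or.inr ⟨h1, h2, h3, h4, h⟩
  · rintro (⟨rfl, rfl⟩ | h)
    · exact ⟨H.pos, H.base, tau_zero, tau_B⟩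
    · exact ⟨h.1, h.2.1, h.2.2.1, h.2.2.2.1⟩

def Concl (m B : ℕ) (R : ℕ → ℕ → Prop) : Prop :=
  ∃ F : Finset (ℕ × ℕ), (∀ c e, (c, e) ∈ F ↔ (c < e ∧ R c e ∧ Tau B R c ∧ Tau B R e)) ∧
    ((F.card = m + 3 ∧ ∀ x, Tau B R x → ∃ y, R x y) ∨
     ∃ p q, p < q ∧ Tau B R p ∧ Tau B R q ∧
      (∃ y, R p y ∧ Tau B R y) ∧ (∃ y, R q y ∧ Tau B R y) ∧
      (∀ x, p < x → x < q → Tau B R x ∧ ∀ y, ¬ R x y) ∧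
      ((∃ k, 1 ≤ k ∧ k ≤ m + 1 ∧ F.card = k ∧ q - p = m + k - 1) ∨
        (F.card = 1 ∧ q - p = 2 * m + 1)))

lemma closed_case (H : Hyp m N B R) (hm : 1 ≤ m) (T : Run m B R 0 r t) (hr : t r = B) :
    Concl m B R := by
  have hpos := H.pos
  have iso : ∀ i ≤ r, ∃ y, R (t i) y := fun i hi => T.nonIso H ⟨_, H.base⟩ hi
  refine ⟨insert (0, B) T.pairs, ?_, Or.inl ⟨?_, ?_⟩⟩
  · intro c e
    rw [bd_iff H, Finset.mem_insert]
    by_cases hc : c ≤ B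
    · rw [T.mem_pairs (Nat.zero_le _) (by omega)]
      simp
    · constructor
      · rintro (h | h)
        · simp at h; omega
        · have := T.pairs_bound h; omega
      · rintro (h | h)
        · omega
        · have := h.2.2.1.1; omega
  · rw [Finset.card_insert_of_notMem, T.card_pairs]
    · -- r = m + 2
      obtain ⟨c, hc⟩ := T.cong H (le_refl r)
      obtain ⟨d, hd⟩ := H.dvd H.base H.pos
      have hr0 : r ≠ 0 := by
        rintro rfl
        have := T.zero
        omega
      have hr1 : r ≠ 1 := by
        rintro rfl
        have h := T.step 0 (by omega)
        exact h.2.2.2.2 ⟨T.zero, hr⟩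
      have hlt : r < 2 * m + 3 := by
        by_contra hge
        obtain ⟨c, hc⟩ := T.cong H (i := m + 2) (by omega)
        have h1 := T.mono (j := m + 2) (by omega) 0 (by omega)
        have h0 := T.zero
        have h2 := T.mono (j := r) (by omega) (m + 2) (by omega)
        have h3 := T.mono (j := m + 2) (by omega) 1 (by omega)
        have hs := H.chord' (T.tau (i := 0) (by omega)) (T.tau (i := m + 2) (by omega)) h1
          ⟨c - 1, by
            have : 1 ≤ c := by
              rcases c with _ | c
              · omega
              · omega
            obtain ⟨c, rfl⟩ := Nat.exists_eq_add_of_le this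
            simp only [mul_add, mul_one] at hc
            simp only [Nat.add_sub_cancel_left]
            omega⟩
          (iso _ (by omega)) (iso _ (by omega)) (by omega)
        have := step_unique hs (T.step 0 (by omega))
        simp at this
        omega
      -- B + r = (m+1) c, B + 1 = (m+1) d
      have : ((m + 1 : ℕ) : ℤ) ∣ (r : ℤ) - 1 := ⟨c - d, by
        rw [hr] at hc
        zify at hc hd
        simp at hd
        push_cast
        linarith⟩
      obtain ⟨f, hf⟩ := this
      have hf0 : 0 < f := by
        by_contra hneg
        nlinarith [show (2 : ℤ) ≤ r by omega]
      have hf2 : f < 2 := by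
        by_contra hneg
        push Not at hneg
        have : ((m + 1 : ℕ) : ℤ) * 2 ≤ (m + 1 : ℕ) * f := by gcongr
        push_cast at *
        omega
      have : f = 1 := by omega
      subst this
      push_cast at hf
      omega
    · intro h
      have := (T.mem_pairs (Nat.zero_le _) (by omega)).1 h
      exact this.2.2.2.2 ⟨rfl, rfl⟩
  · intro x hx
    obtain ⟨i, hi, rfl⟩ := T.find hx (Nat.zero_le _) le_rfl (by have := hx.1; omega)
    exact iso i hi

lemma main (H : Hyp m N B R) (hm : 1 ≤ m) : Concl m B R := by
  classical
  obtain ⟨α, t, T⟩ := exists_run (m := m) B 0 (by omega) (tau_zero (B := B) (R := R))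
  by_cases hcl : t α = B
  · exact closed_case H hm T hcl
  have hpos := H.pos
  have hBN := H.lt (H.symm H.base)
  have isoT : ∀ i ≤ α, ∃ y, R (t i) y := fun i hi => T.nonIso H ⟨_, H.base⟩ hi
  obtain ⟨p, hp⟩ : ∃ p, p = t α := ⟨_, rfl⟩
  have hpτ : Tau B R p := hp ▸ T.last
  have hpB : p < B := lt_of_le_of_ne hpτ.1 (hp ▸ hcl)
  have hpn : ∀ y, ¬ Step B R p y := hp ▸ T.halt
  have hex : ∃ q, p < q ∧ ∃ y, R q y := ⟨B, hpB, 0, H.symm H.base⟩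
  obtain ⟨q, ⟨hpq, hqi⟩, hqmin⟩ : ∃ q, (p < q ∧ ∃ y, R q y) ∧
      ∀ x, p < x → x < q → ∀ y, ¬ R x y :=
    ⟨Nat.find hex, Nat.find_spec hex, fun x h1 h2 y hy => Nat.find_min hex h2 ⟨h1, y, hy⟩⟩
  have hqB : q ≤ B := by
    by_contra h
    exact hqmin B hpB (by omega) _ (H.symm H.base)
  have hgap : ∀ x, p ≤ x → x ≤ q → Tau B R x := by
    intro x hx
    induction x, hx using Nat.le_induction with
    | base => intro _; exact hpτ
    | succ x hx ih =>
      intro hxq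
      refine H.unit (ih (by omega)) ?_ (by omega)
      intro y hy
      rcases hx.lt_or_eq with h | h
      · exact hqmin x h (by omega) y hy.2.1
      · exact hpn y (h ▸ hy)
  have hqτ := hgap q hpq.le le_rfl
  obtain ⟨β, s, Q⟩ := exists_run (m := m) B q (by omega) hqτ
  have isoQ : ∀ i ≤ β, ∃ y, R (s i) y := fun i hi => Q.nonIso H hqi hi
  have hq0 : s 0 = q := Q.zero
  have hsq : ∀ j ≤ β, q ≤ s j := by
    intro j hj
    rcases j with _ | j
    · omega
    · have := Q.mono hj 0 (by omega); omega
  have hlast : s β = B := by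
    by_contra hne
    have h1 := Q.last.1
    have h2 := hsq β le_rfl
    have key : ∀ x y, R x y → (p < x ∧ x ≤ s β) → (p < y ∧ y ≤ s β) := by
      intro x y hxy ⟨hx1, hx2⟩
      constructor
      · by_contra hy
        push Not at hy
        have hyx := H.symm hxy
        -- y ≤ p < x ≤ s β < B
        rcases hy.lt_or_eq with h | h
        · exact hpτ.2 y x hyx (by omega) (by omega) h hx1
        · subst h
          have := H.no_step hpτ hpn x hyx hx1 (by omega)
          omega
      · by_contra hy
        push Not at hy
        by_cases hyB : y ≤ B
        · rcases hx2.lt_or_eq with h | h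
          · exact Q.last.2 x y hxy hyB (by omega) h hy
          · subst h
            have := H.no_step Q.last Q.halt y hxy hy hyB
            omega
        · exact H.nc H.base hxy (by omega) (by omega) (by omega)
    obtain ⟨y, hy⟩ := hqi
    have := H.conn {x | p < x ∧ x ≤ s β} key q y hy ⟨hpq, h2⟩ 0 B H.base
    have := this.1
    omega
  -- farness of p and q
  have hu1 : m + 1 ≤ q - p := by
    obtain ⟨y, hy⟩ := isoT α le_rfl
    obtain ⟨z, hz⟩ := hqi
    have := ((hp ▸ H.far hy hz : Far m N p q)).2 hpq
    omega
  obtain ⟨c1, hc1⟩ := T.cong H (le_refl α)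
  rw [← hp] at hc1
  obtain ⟨c2, hc2⟩ := Q.cong H (le_refl β)
  obtain ⟨d, hd⟩ := H.dvd H.base H.pos
  have hu2 : q - p ≤ 2 * m + 1 := by
    by_contra hlt
    push Not at hlt
    have zt : Tau B R (p + m + 1) := hgap _ (by omega) (by omega)
    have zf : ∀ z w, R z w → Far m N (p + m + 1) z := by
      intro z w h
      have hzN := H.lt h
      have : z ≤ p ∨ q ≤ z := by
        by_contra hh
        push Not at hh
        exact hqmin z hh.1 hh.2 w h
      constructor <;> intro _ <;> omega
    have ziso : ∀ y, ¬ R (p + m + 1) y := hqmin _ (by omega) (by omega)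
    rcases Nat.eq_zero_or_pos α with h | h
    · have hp0 : p = 0 := by rw [hp, h, T.zero]
      subst hp0
      refine ziso _ (H.chord (y := B) zt tau_B (by omega) ⟨d - 1, ?_⟩ zf
        (fun _ _ h => H.far (H.symm H.base) h))
      obtain ⟨e, rfl⟩ : ∃ e, d = e + 1 := ⟨d - 1, by rcases d with _ | d <;> simp at hd ⊢⟩
      simp only [mul_add, mul_one] at hd
      simp only [Nat.add_sub_cancel]
      omega
    · have hs := T.step (α - 1) (by omega)
      rw [Nat.sub_add_cancel h, ← hp] at hs
      obtain ⟨e, he⟩ := H.dvd hs.2.1 hs.1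
      have := hs.1
      refine ziso _ (H.symm (H.chord hs.2.2.1 zt (by omega) ⟨e + 1, ?_⟩
        (fun _ _ h => H.far hs.2.1 h) zf))
      rw [mul_add]
      omega
  have hl : α + β ≤ m := by
    by_contra hlt
    push Not at hlt
    by_cases hα : m + 2 ≤ α
    · obtain ⟨c, hc⟩ := T.cong H (i := m + 2) (by omega)
      have h1 := T.mono (j := m + 2) (by omega) 0 (by omega)
      have h0 := T.zero
      have h2 : t (m + 2) ≤ p := by
        rcases hα.lt_or_eq with h | h
        · exact hp ▸ (T.mono (j := α) (by omega) (m + 2) (by omega)).le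
        · rw [hp, h]
      have h3 := T.mono (j := m + 2) (by omega) 1 (by omega)
      have hs := H.chord' (T.tau (i := 0) (by omega)) (T.tau (i := m + 2) (by omega)) h1
          ⟨c - 1, by
            have : 1 ≤ c := by
              rcases c with _ | c
              · omega
              · omega
            obtain ⟨c, rfl⟩ := Nat.exists_eq_add_of_le this
            simp only [mul_add, mul_one] at hc
            simp only [Nat.add_sub_cancel_left]
            omega⟩
          (isoT _ (by omega)) (isoT _ (by omega)) (by omega)
      have := step_unique hs (T.step 0 (by omega))
      simp at this
      omega
    · obtain ⟨j, hj⟩ : ∃ j, j + (m + 1) = α + β := ⟨α + β - (m + 1), by omega⟩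
      have hjβ : j ≤ β := by omega
      obtain ⟨c, hc⟩ := Q.cong H hjβ
      have hjq := hsq j hjβ
      refine hpn (s j) (H.chord' hpτ (Q.tau hjβ) (by omega) ?_ (hp ▸ isoT α le_rfl)
        (isoQ j hjβ) ?_)
      · -- s j + j = q + (m+1) c ; p + α = (m+1) c1; B + β = q + (m+1) c2; B + 1 = (m+1) d
        zify
        rw [Nat.cast_sub (by omega)]
        refine ⟨(c : ℤ) - c2 + d - c1 + 1, ?_⟩
        rw [hlast] at hc2
        zify at hc hc1 hc2 hd hj
        simp at hd
        linarith
      · rintro ⟨h0, hsB⟩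
        have : j = β := Q.inj hjβ le_rfl (by omega)
        have hα0 : α = 0 := T.inj le_rfl (by omega) (by rw [← hp, T.zero, h0])
        omega
  -- assemble
  refine ⟨insert (0, B) (T.pairs ∪ Q.pairs), ?_, Or.inr ⟨p, q, hpq, hpτ, hqτ, ?_, ?_, ?_, ?_⟩⟩
  · intro c e
    rw [bd_iff H, Finset.mem_insert, Finset.mem_union]
    have e1 : ((c, e) : ℕ × ℕ) = (0, B) ↔ c = 0 ∧ e = B := by simp
    rw [e1]
    refine or_congr Iff.rfl ?_
    constructor
    · rintro (h | h)
      · have := T.pairs_bound h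
        exact (T.mem_pairs (by omega) (by omega)).1 h
      · have := Q.pairs_bound h
        exact (Q.mem_pairs (by omega) (by omega)).1 h
    · intro h
      have h1 := h.2.2.1.1
      by_cases hcp : c ≤ p
      · exact Or.inl ((T.mem_pairs (by omega) (by omega)).2 h)
      · by_cases hcq : q ≤ c
        · exact Or.inr ((Q.mem_pairs (by omega) (by omega)).2 h)
        · exact (hqmin c (by omega) (by omega) e h.2.1).elim
  · rcases Nat.eq_zero_or_pos α with h | h
    · have hp0 : p = 0 := by rw [hp, h, T.zero]
      exact ⟨B, hp0 ▸ H.base, tau_B⟩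
    · have hs := T.step (α - 1) (by omega)
      rw [Nat.sub_add_cancel h, ← hp] at hs
      exact ⟨_, H.symm hs.2.1, hs.2.2.1⟩
  · rcases Nat.eq_zero_or_pos β with h | h
    · have hq' : q = B := by rw [← hlast, h, hq0]
      exact ⟨0, hq' ▸ H.symm H.base, tau_zero⟩
    · have hs := Q.step 0 (by omega)
      rw [hq0] at hs
      exact ⟨_, hs.2.1, hs.2.2.2.1⟩
  · intro x h1 h2
    exact ⟨hgap x h1.le h2.le, hqmin x h1 h2⟩
  · have hcard : (insert (0, B) (T.pairs ∪ Q.pairs)).card = α + β + 1 := by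
      rw [Finset.card_insert_of_notMem, Finset.card_union_of_disjoint, T.card_pairs, Q.card_pairs]
      · rw [Finset.disjoint_left]
        rintro ⟨c, e⟩ h h'
        have := T.pairs_bound h
        have := Q.pairs_bound h'
        omega
      · rw [Finset.mem_union]
        rintro (h | h)
        · have := T.pairs_bound h
          exact ((T.mem_pairs (by omega) (by omega)).1 h).2.2.2.2 ⟨rfl, rfl⟩
        · have := Q.pairs_bound h
          exact ((Q.mem_pairs (by omega) (by omega)).1 h).2.2.2.2 ⟨rfl, rfl⟩
    rw [hcard]
    -- congruence: q - p ≡ α + β - 1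
    obtain ⟨u, hu⟩ : ∃ u, q = p + u := ⟨q - p, by omega⟩
    rw [hlast] at hc2
    have hcong : ((m + 1 : ℕ) : ℤ) ∣ (u : ℤ) + 1 - (α + β) := by
      refine ⟨(d : ℤ) - c1 - c2, ?_⟩
      zify at hc1 hc2 hd hu
      simp at hd
      push_cast
      linarith
    obtain ⟨f, hf⟩ := hcong
    have hsub : q - p = u := by omega
    rw [hsub] at hu1 hu2 ⊢
    push_cast at hf
    have hf1 : 0 < f := by
      by_contra hneg
      push Not at hneg
      have : ((m : ℤ) + 1) * f ≤ 0 := mul_nonpos_of_nonneg_of_nonpos (by omega) hneg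
      omega
    have hf3 : f < 3 := by
      by_contra hneg
      push Not at hneg
      have : ((m : ℤ) + 1) * 3 ≤ (m + 1) * f := by gcongr
      omega
    have : f = 1 ∨ f = 2 := by omega
    rcases this with rfl | rfl
    · left
      exact ⟨α + β + 1, by omega, by omega, rfl, by omega⟩
    · right
      constructor <;> omega

end Core

lemma val_sub_add {N : ℕ} [NeZero N] (a : ZMod N) {x y : ℕ} (hx : x < N) (hy : y < N) :
    ((a + (y : ZMod N)) - (a + (x : ZMod N))).val = if x ≤ y then y - x else y + N - x := by
  rw [add_sub_add_left_eq_sub]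
  split_ifs with h
  · rw [← Nat.cast_sub h, ZMod.val_natCast_of_lt (by omega)]
  · have : (y : ZMod N) - x = ((y + N - x : ℕ) : ZMod N) := by
      rw [Nat.cast_sub (by omega)]; simp
    rw [this, ZMod.val_natCast_of_lt (by omega)]

lemma coord_inj {N : ℕ} [NeZero N] (a : ZMod N) {x y : ℕ} (hx : x < N) (hy : y < N)
    (h : a + (x : ZMod N) = a + (y : ZMod N)) : x = y := by
  have h1 := congrArg ZMod.val (add_left_cancel h)
  rwa [ZMod.val_natCast_of_lt hx, ZMod.val_natCast_of_lt hy] at h1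

lemma coord_eq {N : ℕ} [NeZero N] (a v : ZMod N) : a + (((v - a).val : ℕ) : ZMod N) = v := by
  rw [ZMod.natCast_zmod_val]; ring

lemma exists_coord {N : ℕ} [NeZero N] (a v : ZMod N) : ∃ x < N, v = a + (x : ZMod N) :=
  ⟨(v - a).val, ZMod.val_lt _, (coord_eq a v).symm⟩

lemma coord_val {N : ℕ} [NeZero N] (a : ZMod N) {x : ℕ} (hx : x < N) :
    ((a + (x : ZMod N)) - a).val = x := by
  rw [add_sub_cancel_left, ZMod.val_natCast_of_lt hx]

lemma cw_coord {N : ℕ} [NeZero N] (a : ZMod N) {x z y w : ℕ} (hx : x < N) (hz : z < N)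
    (hy : y < N) (hw : w < N) :
    CW [a + (x : ZMod N), a + (z : ZMod N), a + (y : ZMod N), a + (w : ZMod N)] ↔
      (x < z ∧ z < y ∧ y < w) ∨ (z < y ∧ y < w ∧ w < x) ∨ (y < w ∧ w < x ∧ x < z) ∨
      (w < x ∧ x < z ∧ z < y) := by
  have hinj : ∀ {i j : ℕ}, i < N → j < N → ((a + (i : ZMod N) = a + (j : ZMod N)) ↔ i = j) :=
    fun hi hj => ⟨coord_inj a hi hj, fun h => by rw [h]⟩
  unfold CW
  simp only [List.rotate_cons_succ, List.rotate_zero, List.cons_append, List.nil_append,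
    List.zip_cons_cons, List.zip_nil_right, List.map_cons, List.map_nil, List.sum_cons,
    List.sum_nil, val_sub_add a hx hz, val_sub_add a hz hy, val_sub_add a hy hw,
    val_sub_add a hw hx, List.nodup_cons, List.mem_cons, List.not_mem_nil, or_false,
    hinj hx hz, hinj hx hy, hinj hx hw, hinj hz hy, hinj hz hw, hinj hy hw]
  constructor
  · rintro ⟨h1, h2⟩
    split_ifs at h2 <;> omega
  · intro h
    refine ⟨by simp; omega, ?_⟩
    split_ifs <;> omega

lemma crosses_of {N : ℕ} [NeZero N] (a : ZMod N) {x z y w : ℕ} (h1 : x < z) (h2 : z < y)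
    (h3 : y < w) (hw : w < N) :
    Crosses s(a + (x : ZMod N), a + (y : ZMod N)) s(a + (z : ZMod N), a + (w : ZMod N)) :=
  ⟨_, _, _, _, rfl, rfl, (cw_coord a (by omega) (by omega) (by omega) hw).2 (by omega)⟩

lemma of_crosses {N : ℕ} [NeZero N] (a : ZMod N) {x z y w : ℕ} (hxy : x < y) (hzw : z < w)
    (hy : y < N) (hw : w < N)
    (h : Crosses s(a + (x : ZMod N), a + (y : ZMod N)) s(a + (z : ZMod N), a + (w : ZMod N))) :
    (x < z ∧ z < y ∧ y < w) ∨ (z < x ∧ x < w ∧ w < y) := by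
  obtain ⟨a1, b1, a2, b2, h1, h2, hc⟩ := h
  have hx : x < N := by omega
  have hz : z < N := by omega
  rcases Sym2.eq_iff.1 h1 with ⟨rfl, rfl⟩ | ⟨rfl, rfl⟩ <;>
  rcases Sym2.eq_iff.1 h2 with ⟨rfl, rfl⟩ | ⟨rfl, rfl⟩
  · rw [cw_coord a hx hz hy hw] at hc; omega
  · rw [cw_coord a hx hw hy hz] at hc; omega
  · rw [cw_coord a hy hz hx hw] at hc; omega
  · rw [cw_coord a hy hw hx hz] at hc; omega

lemma Crosses.symm' {N : ℕ} [NeZero N] {d e : Sym2 (ZMod N)} (h : Crosses d e) : Crosses e d := by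
  obtain ⟨a1, b1, a2, b2, h1, h2, hc⟩ := h
  refine ⟨b1, a2, b2, a1, h2, by rw [h1, Sym2.eq_swap], ?_⟩
  obtain ⟨x, hx, rfl⟩ := exists_coord 0 a1
  obtain ⟨y, hy, rfl⟩ := exists_coord 0 a2
  obtain ⟨z, hz, rfl⟩ := exists_coord 0 b1
  obtain ⟨w, hw, rfl⟩ := exists_coord 0 b2
  rw [cw_coord _ hx hz hy hw] at hc
  rw [cw_coord _ hz hy hw hx]
  omega

/-- a diagonal compatible with everything belongs to a maximal rigid set -/
lemma rigid_add {m N : ℕ} [NeZero N] (hN : 2 * m < N) {S : Set (Sym2 (ZMod N))}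
    (hmax : MaxMRigid m S) {d : Sym2 (ZMod N)} (hd : IsMDiag m d)
    (hnc : ∀ e ∈ S, ¬ Crosses d e)
    (hfar : ∀ e ∈ S, ∀ v ∈ d, ∀ w ∈ e, ∀ k : ℕ, 1 ≤ k → k ≤ m →
      w ≠ v + (k : ZMod N) ∧ v ≠ w + (k : ZMod N)) : d ∈ S := by
  by_contra hdS
  refine hmax.2.2 d hd hdS ?_
  have hshift : ∀ (k : ℕ) (e : Sym2 (ZMod N)) (v : ZMod N), v ∈ e → v + (k : ZMod N) ∈ shiftD k e :=
    fun k e v hv => Sym2.mem_map.2 ⟨v, hv, rfl⟩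
  obtain ⟨i, j, rfl⟩ : ∃ i j, d = s(i, j) := by
    induction d using Sym2.ind with | _ i j => exact ⟨i, j, rfl⟩
  have hex : ∀ e : Sym2 (ZMod N), ∃ v, v ∈ e := by
    intro e
    induction e using Sym2.ind with | _ i j => exact ⟨i, by simp⟩
  intro a ha b hb k hk1 hkm hE
  rcases Set.mem_insert_iff.1 ha with rfl | ha <;> rcases Set.mem_insert_iff.1 hb with rfl | hb
  · rcases hE with h | h | h
    · exact h.1.1 rfl
    · obtain ⟨a1, b1, a2, b2, h1, h2, hc, -, -⟩ := h
      have hnd := hc.1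
      simp only [List.nodup_cons, List.mem_cons, List.not_mem_nil, or_false] at hnd
      rcases Sym2.eq_iff.1 (h1.symm.trans h2) with ⟨h, -⟩ | ⟨h, -⟩ <;> simp_all
    · simp only [shiftD, Sym2.map_mk, Sym2.eq_iff] at h
      rcases h with ⟨h, -⟩ | ⟨h, h'⟩
      · have h0 : (k : ZMod N) = 0 := by simpa using h
        have := congrArg ZMod.val h0
        rw [ZMod.val_natCast_of_lt (by omega), ZMod.val_zero] at this
        omega
      · rw [h] at h'
        have h0 : ((2 * k : ℕ) : ZMod N) = 0 := by
          push_cast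
          linear_combination -h'
        have := congrArg ZMod.val h0
        rw [ZMod.val_natCast_of_lt (by omega), ZMod.val_zero] at this
        omega
  · rcases hE with h | h | h
    · obtain ⟨-, v, hv, hvk⟩ := h
      exact (hfar b hb v hv _ hvk k hk1 hkm).1 rfl
    · obtain ⟨a1, b1, a2, b2, h1, h2, hc, -, -⟩ := h
      exact hnc b hb ⟨a1, b1, a2, b2, h1, h2, hc⟩
    · have := hshift k s(i, j) i (by simp)
      rw [← h] at this
      exact (hfar b hb i (by simp) _ this k hk1 hkm).1 rfl
  · rcases hE with h | h | h
    · obtain ⟨-, v, hv, hvk⟩ := h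
      exact (hfar a ha _ hvk v hv k hk1 hkm).2 rfl
    · obtain ⟨a1, b1, a2, b2, h1, h2, hc, -, -⟩ := h
      exact hnc a ha (Crosses.symm' ⟨a1, b1, a2, b2, h1, h2, hc⟩)
    · obtain ⟨v, hv⟩ := hex a
      have := hshift k a v hv
      rw [← h] at this
      exact (hfar a ha _ this v hv k hk1 hkm).2 rfl
  · exact hmax.2.1 a ha b hb k hk1 hkm hE

lemma rigid_nbr {m N : ℕ} {S : Set (Sym2 (ZMod N))} (hr : MRigid m S)
    (hnc : ∀ a ∈ S, ∀ b ∈ S, ¬ Crosses a b) {d e : Sym2 (ZMod N)} (hd : d ∈ S) (he : e ∈ S)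
    (hne : d ≠ e) {v : ZMod N} {k : ℕ} (hk : 1 ≤ k) (hkm : k ≤ m) (hv : v ∈ d)
    (hvk : v + (k : ZMod N) ∈ e) : False :=
  hr d hd e he k hk hkm (Or.inl ⟨⟨hne, hnc d hd e he, v, hv, Or.inl hvk⟩, v, hv, hvk⟩)

lemma conn_set {N : ℕ} {S : Set (Sym2 (ZMod N))} (hconn : ConnectedSet S) (W : Set (ZMod N))
    (hW : ∀ u v, s(u, v) ∈ S → u ∈ W → v ∈ W) {u v u' v' : ZMod N} (h : s(u, v) ∈ S) (hu : u ∈ W)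
    (h' : s(u', v') ∈ S) : u' ∈ W := by
  have h1 : ¬ Isolated S u := fun hh => hh _ h (by simp)
  have h2 : ¬ Isolated S u' := fun hh => hh _ h' (by simp)
  have hre := hconn.preconnected ⟨u, h1⟩ ⟨u', h2⟩
  rw [SimpleGraph.reachable_iff_reflTransGen] at hre
  have : ∀ x, Relation.ReflTransGen
      ((graphOf S).induce {v : ZMod N | ¬ Isolated S v}).Adj ⟨u, h1⟩ x → x.1 ∈ W := by
    intro x hx
    induction hx with
    | refl => exact hu
    | tail _ hadj ih =>
      simp only [graphOf, SimpleGraph.comap_adj, SimpleGraph.fromEdgeSet_adj,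
        Function.Embedding.subtype_apply] at hadj
      exact hW _ _ hadj.1 ih
  exact this _ hre

/-- the relation in coordinates based at `a` -/
def Rel (S : Set (Sym2 (ZMod M))) (a : ZMod M) (x y : ℕ) : Prop :=
  x < M ∧ y < M ∧ s(a + (x : ZMod M), a + (y : ZMod M)) ∈ S

lemma Rel.symm {S : Set (Sym2 (ZMod M))} {a : ZMod M} {x y : ℕ} (h : Rel S a x y) :
    Rel S a y x := ⟨h.2.1, h.1, by rw [Sym2.eq_swap]; exact h.2.2⟩

lemma rel_coord {N : ℕ} [NeZero N] {S : Set (Sym2 (ZMod N))} (a : ZMod N) {c e : ZMod N} :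
    Rel S a (c - a).val (e - a).val ↔ s(c, e) ∈ S := by
  unfold Rel
  rw [coord_eq, coord_eq]
  exact ⟨fun h => h.2.2, fun h => ⟨ZMod.val_lt _, ZMod.val_lt _, h⟩⟩

lemma mdiag_iff {m N : ℕ} [NeZero N] (hN : (m + 1) ∣ N + 2) (a : ZMod N) {x y : ℕ} (hxy : x < y)
    (hy : y < N) : IsMDiag m s(a + (x : ZMod N), a + (y : ZMod N)) ↔ (m + 1) ∣ y - x + 1 := by
  have hx : x < N := by omega
  constructor
  · intro h
    have := h.2 _ _ rfl
    rwa [cnt, val_sub_add a hx hy, if_pos hxy.le] at this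
  · intro h
    refine ⟨fun hd => ?_, ?_⟩
    · have := coord_inj a hx hy (Sym2.mk_isDiag_iff.1 hd)
      omega
    · intro i j hij
      rcases Sym2.eq_iff.1 hij with ⟨rfl, rfl⟩ | ⟨rfl, rfl⟩
      · rwa [cnt, val_sub_add a hx hy, if_pos hxy.le]
      · rw [cnt, val_sub_add a hy hx, if_neg (by omega)]
        have := (Nat.dvd_sub hN h)
        convert this using 1
        omega

lemma far_ne {m N : ℕ} [NeZero N] (hN : 2 * m < N) (a : ZMod N) {x z : ℕ} (hx : x < N) (hz : z < N)
    (h : Core.Far m N x z) {k : ℕ} (hk : 1 ≤ k) (hkm : k ≤ m) :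
    a + (z : ZMod N) ≠ a + (x : ZMod N) + (k : ZMod N) ∧
    a + (x : ZMod N) ≠ a + (z : ZMod N) + (k : ZMod N) := by
  constructor
  · intro he
    have h1 := val_sub_add a hx hz
    rw [he, add_sub_cancel_left, ZMod.val_natCast_of_lt (by omega)] at h1
    have h2 := h.1
    have h3 := h.2
    split_ifs at h1 <;> omega
  · intro he
    have h1 := val_sub_add a hz hx
    rw [he, add_sub_cancel_left, ZMod.val_natCast_of_lt (by omega)] at h1
    have h2 := h.1
    have h3 := h.2
    split_ifs at h1 <;> omega

lemma hyp_of {m N : ℕ} [NeZero N] (hN : 2 * m < N) (hdv : (m + 1) ∣ N + 2)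
    {S : Set (Sym2 (ZMod N))} (hmax : MaxMRigid m S) (hconn : ConnectedSet S)
    (hnc : ∀ a ∈ S, ∀ b ∈ S, ¬ Crosses a b) (hlong : ∀ d ∈ S, ¬ IsShort m d)
    {a b : ZMod N} (hab : s(a, b) ∈ S) : Core.Hyp m N (b - a).val (Rel S a) := by
  have hne : ∀ {x y}, Rel S a x y → x ≠ y := by
    rintro x y h rfl
    exact (hmax.1 _ h.2.2).1 (by simp)
  have hself : ∀ (d) (_ : d ∈ S) (e) (_ : e ∈ S) (v : ZMod N) (k : ℕ), 1 ≤ k → k ≤ m → v ∈ d →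
      v + (k : ZMod N) ∈ e → False := by
    intro d hd e he v k hk hkm hv hvk
    by_cases hde : d = e
    · subst hde
      have hvne : v ≠ v + (k : ZMod N) := by
        intro h
        have h0 : (k : ZMod N) = 0 := by simpa using h.symm
        have := congrArg ZMod.val h0
        rw [ZMod.val_natCast_of_lt (by omega), ZMod.val_zero] at this
        omega
      have hd' : d = s(v, v + (k : ZMod N)) := (Sym2.mem_and_mem_iff hvne).1 ⟨hv, hvk⟩
      have h1 := (hmax.1 d hd).2 _ _ hd'
      rw [cnt, add_sub_cancel_left, ZMod.val_natCast_of_lt (by omega)] at h1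
      have := Nat.le_of_dvd (by omega) h1
      have : k = m := by omega
      subst this
      exact hlong d hd ⟨v, hd'⟩
    · exact rigid_nbr hmax.2.1 hnc hd he hde hk hkm hv hvk
  have hfar1 : ∀ {x y z w}, Rel S a x y → Rel S a z w → x < z → m < z - x ∧ z - x + m < N := by
    intro x y z w h1 h2 hlt
    have := h2.1
    constructor
    · by_contra hle
      refine hself _ h1.2.2 _ h2.2.2 (a + (x : ZMod N)) (z - x) (by omega) (by omega) (by simp) ?_
      rw [add_assoc, ← Nat.cast_add, Nat.add_sub_cancel' hlt.le]
      simp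
    · by_contra hle
      refine hself _ h2.2.2 _ h1.2.2 (a + (z : ZMod N)) (x + N - z) (by omega) (by omega)
        (by simp) ?_
      rw [add_assoc, ← Nat.cast_add, Nat.add_sub_cancel' (by omega)]
      simp
  have hB : (b - a).val ≠ 0 := by
    intro h
    have : Rel S a (a - a).val (b - a).val := (rel_coord a).2 hab
    rw [h] at this
    exact hne this (by simp)
  constructor
  · exact fun h => h.1
  · exact Rel.symm
  · exact hne
  · intro x y h hxy
    exact (mdiag_iff hdv a hxy h.2.1).1 (hmax.1 _ h.2.2)
  · intro x y z w h1 h2 h3 h4 h5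
    exact hnc _ h1.2.2 _ h2.2.2 (crosses_of a h3 h4 h5 h2.2.1)
  · intro x y z w h1 h2
    exact ⟨fun h => hfar1 h2 h1 h, fun h => hfar1 h1 h2 h⟩
  · intro x y hxy hy hd c1 c2 f1 f2
    refine ⟨by omega, hy, rigid_add hN hmax ((mdiag_iff hdv a hxy hy).2 hd) ?_ ?_⟩
    · intro e he hc
      obtain ⟨i, j, rfl⟩ : ∃ i j, e = s(i, j) := by
        induction e using Sym2.ind with | _ i j => exact ⟨i, j, rfl⟩
      obtain ⟨z, hz, rfl⟩ := exists_coord a i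
      obtain ⟨w, hw, rfl⟩ := exists_coord a j
      have hr : Rel S a z w := ⟨hz, hw, he⟩
      rcases lt_trichotomy z w with h | h | h
      · rcases of_crosses a hxy h hy hw hc with ⟨h1, h2, h3⟩ | ⟨h1, h2, h3⟩
        · exact c1 z w hr h1 h2 h3
        · exact c2 z w hr h1 h2 h3
      · exact hne hr h
      · rw [Sym2.eq_swap (a := a + (z : ZMod N))] at hc
        rcases of_crosses a hxy h hy hz hc with ⟨h1, h2, h3⟩ | ⟨h1, h2, h3⟩
        · exact c1 w z hr.symm h1 h2 h3
        · exact c2 w z hr.symm h1 h2 h3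
    · intro e he v hv w hw k hk hkm
      obtain ⟨j, rfl⟩ : ∃ j, e = s(w, j) := hw
      obtain ⟨z, hz, rfl⟩ := exists_coord a w
      obtain ⟨w', hw', rfl⟩ := exists_coord a j
      have hr : Rel S a z w' := ⟨hz, hw', he⟩
      rcases Sym2.mem_iff.1 hv with rfl | rfl
      · exact far_ne hN a (by omega) hz (f1 z w' hr) hk hkm
      · exact far_ne hN a hy hz (f2 z w' hr) hk hkm
  · intro W hW x y hxy hx z w hzw
    have := conn_set hconn {v | (v - a).val ∈ W} (by
      intro u v huv hu
      exact hW _ _ ((rel_coord a).2 huv) hu) hxy.2.2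
      (show ((a + (x : ZMod N)) - a).val ∈ W by rwa [coord_val a hxy.1]) hzw.2.2
    have h2 : ((a + (z : ZMod N)) - a).val ∈ W := this
    rwa [coord_val a hzw.1] at h2
  · have : Rel S a (a - a).val (b - a).val := (rel_coord a).2 hab
    simpa using this
  · omega

lemma mem_tile {N : ℕ} [NeZero N] {S : Set (Sym2 (ZMod N))} {a b : ZMod N} (hne : a ≠ b)
    (v : ZMod N) : v ∈ tileAt S a b ↔ Core.Tau (b - a).val (Rel S a) (v - a).val := by
  have hB : (b - a).val ≠ 0 := by
    rw [Ne, ZMod.val_eq_zero, sub_eq_zero]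
    exact hne.symm
  simp only [tileAt, Set.mem_setOf_eq, cnt, Core.Tau, Nat.add_le_add_iff_right,
    Nat.add_lt_add_iff_right]
  refine and_congr Iff.rfl ⟨fun h c e hce heB hn h1 h2 => ?_, fun h c e hce hn hle heB hh => ?_⟩
  · refine h _ _ hce.2.2 ?_ ?_ ?_ ?_
    · intro heq
      rcases Sym2.eq_iff.1 heq with ⟨h3, h4⟩ | ⟨h3, h4⟩
      · refine hn ⟨?_, ?_⟩
        · rw [← coord_val a hce.1, h3]; simp
        · rw [← coord_val a hce.2.1, h4]
      · have : e = 0 := by rw [← coord_val a hce.2.1, h4]; simp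
        omega
    · rw [coord_val a hce.1, coord_val a hce.2.1]; omega
    · rwa [coord_val a hce.2.1]
    · rw [coord_val a hce.1, coord_val a hce.2.1]; exact ⟨h1, h2⟩
  · refine h _ _ ((rel_coord a).2 hce) heB ?_ hh.1 hh.2
    rintro ⟨h1, h2⟩
    rw [ZMod.val_eq_zero, sub_eq_zero] at h1
    have h2 := ZMod.val_injective N h2
    rw [sub_left_inj] at h2
    rw [h1, h2] at hn
    exact hn rfl

lemma strictIn_coord {N : ℕ} [NeZero N] (a : ZMod N) {p q : ℕ} (hp : p < q) (hq : q < N)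
    (v : ZMod N) : StrictIn (a + (p : ZMod N)) (a + (q : ZMod N)) v ↔
      p < (v - a).val ∧ (v - a).val < q := by
  obtain ⟨x, hx, rfl⟩ := exists_coord a v
  rw [StrictIn, cnt, cnt, val_sub_add a (by omega) hx, val_sub_add a (by omega) hq,
    coord_val a hx, if_pos hp.le]
  split_ifs <;> omega

lemma long_case {m N : ℕ} [NeZero N] (hm : 1 ≤ m) (hN : 2 * m < N) (hdv : (m + 1) ∣ N + 2)
    {S : Set (Sym2 (ZMod N))} (hmax : MaxMRigid m S) (hconn : ConnectedSet S)
    (hnc : ∀ a ∈ S, ∀ b ∈ S, ¬ Crosses a b) (hlong : ∀ d ∈ S, ¬ IsShort m d) :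
    GoodTiles m S := by
  rintro T ⟨a, b, hab, rfl⟩
  have H := hyp_of hN hdv hmax hconn hnc hlong hab
  have hne : a ≠ b := fun h => (hmax.1 _ hab).1 (by simp [h])
  have hmem := mem_tile (S := S) hne
  obtain ⟨F, hF, hcase⟩ := Core.main H hm
  have hBd : {d | IsBounding S (tileAt S a b) d} =
      (fun P : ℕ × ℕ => s(a + (P.1 : ZMod N), a + (P.2 : ZMod N))) '' (F : Set (ℕ × ℕ)) := by
    ext d
    obtain ⟨i, j, rfl⟩ : ∃ i j, d = s(i, j) := by
      induction d using Sym2.ind with | _ i j => exact ⟨i, j, rfl⟩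
    constructor
    · rintro ⟨hd, hv⟩
      have hr := (rel_coord a).2 hd
      have hi := (hmem i).1 (hv i (by simp))
      have hj := (hmem j).1 (hv j (by simp))
      rcases lt_or_gt_of_ne (H.ne hr) with h | h
      · refine ⟨(_, _), (hF _ _).2 ⟨h, hr, hi, hj⟩, ?_⟩
        simp only [coord_eq]
      · refine ⟨(_, _), (hF _ _).2 ⟨h, hr.symm, hj, hi⟩, ?_⟩
        simp only [coord_eq]
        exact Sym2.eq_swap
    · rintro ⟨⟨c, e⟩, hce, h⟩
      obtain ⟨h1, h2, h3, h4⟩ := (hF c e).1 hce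
      rw [← h]
      refine ⟨h2.2.2, fun v hv => ?_⟩
      rw [hmem]
      rcases Sym2.mem_iff.1 hv with rfl | rfl
      · rwa [coord_val a h2.1]
      · rwa [coord_val a h2.2.1]
  have hlen : tileLen S (tileAt S a b) = F.card := by
    rw [tileLen, hBd, Set.ncard_image_of_injOn, Set.ncard_coe_finset]
    rintro ⟨c, e⟩ h ⟨c', e'⟩ h' heq
    obtain ⟨h1, h2, -, -⟩ := (hF c e).1 h
    obtain ⟨h1', h2', -, -⟩ := (hF c' e').1 h'
    rcases Sym2.eq_iff.1 heq with ⟨h3, h4⟩ | ⟨h3, h4⟩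
    · have := coord_inj a h2.1 h2'.1 h3
      have := coord_inj a h2.2.1 h2'.2.1 h4
      simp; omega
    · have := coord_inj a h2.1 h2'.2.1 h3
      have := coord_inj a h2.2.1 h2'.1 h4
      omega
  rcases hcase with ⟨hcard, hiso⟩ | ⟨p, q, hpq, hp, hq, ⟨yp, hyp, hyp'⟩, ⟨yq, hyq, hyq'⟩, hgap, htype⟩
  · right; right; right; right
    refine ⟨by rw [hlen, hcard], ?_⟩
    rintro ⟨p, q, hpq, hpT, hqT, -, -, hg, -⟩
    have hnon : ∀ v ∈ tileAt S a b, ∃ y, Rel S a (v - a).val y := fun v hv => hiso _ ((hmem v).1 hv)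
    have hq1 : q = p + 1 := by
      by_contra hq1
      have hst : StrictIn p q (p + 1) := by
        obtain ⟨x, hx, rfl⟩ := exists_coord p q
        have hx0 : x ≠ 0 := by rintro rfl; simp at hpq
        have hx1 : x ≠ 1 := by rintro rfl; simp at hq1
        have h1 : ((1 : ℕ) : ZMod N) = 1 := by simp
        rw [StrictIn, cnt, cnt, coord_val p hx, ← h1, coord_val p (by omega)]
        omega
      obtain ⟨h1, h2⟩ := hg _ hst
      obtain ⟨y, hy⟩ := hnon _ h1
      refine h2 _ hy.2.2 ?_
      rw [coord_eq]
      simp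
    obtain ⟨y, hy⟩ := hnon p hpT
    obtain ⟨z, hz⟩ := hnon q hqT
    have hf := H.far hy hz
    have := (far_ne hN a hy.1 hz.1 hf (k := 1) le_rfl hm).1
    rw [coord_eq, coord_eq] at this
    exact this (by simpa using hq1)
  · have hpN := hyp.1
    have hqN := hyq.1
    have hbdry : IsOpenBdry S (tileAt S a b) (a + (p : ZMod N)) (a + (q : ZMod N)) := by
      have hb : ∀ x y, Rel S a x y → Core.Tau (b - a).val (Rel S a) x →
          Core.Tau (b - a).val (Rel S a) y →
          IsBounding S (tileAt S a b) s(a + (x : ZMod N), a + (y : ZMod N)) := by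
        intro x y h hx hy
        refine ⟨h.2.2, fun v hv => ?_⟩
        rw [hmem]
        rcases Sym2.mem_iff.1 hv with rfl | rfl
        · rwa [coord_val a h.1]
        · rwa [coord_val a h.2.1]
      have hisol : ∀ v, StrictIn (a + (p : ZMod N)) (a + (q : ZMod N)) v →
          v ∈ tileAt S a b ∧ Isolated S v := by
        intro v hv
        rw [strictIn_coord a hpq hqN] at hv
        obtain ⟨h1, h2⟩ := hgap _ hv.1 hv.2
        refine ⟨(hmem v).2 h1, fun d hd hvd => ?_⟩
        obtain ⟨j, rfl⟩ : ∃ j, d = s(v, j) := hvd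
        exact h2 _ ((rel_coord a).2 hd)
      refine ⟨fun h => ?_, ?_, ?_, ⟨_, hb _ _ hyp hp hyp', by simp⟩, ⟨_, hb _ _ hyq hq hyq', by simp⟩,
        hisol, fun d hd _ v hv hs => (hisol v hs).2 d hd.1 hv⟩
      · have := coord_inj a hpN hqN h
        omega
      · rwa [hmem, coord_val a hpN]
      · rwa [hmem, coord_val a hqN]
    have hcnt : cnt (a + (p : ZMod N)) (a + (q : ZMod N)) - 1 = q - p := by
      rw [cnt, val_sub_add a hpN hqN, if_pos hpq.le]; simp
    rcases htype with ⟨k, hk1, hk2, hk3, hk4⟩ | ⟨h1, h2⟩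
    · left
      exact ⟨k, hk1, hk2, by rw [hlen, hk3], _, _, hbdry, by rw [hcnt, hk4]⟩
    · right; right; left
      exact ⟨by rw [hlen, h1], _, _, hbdry, by rw [hcnt, h2]⟩

lemma short_case {m n N : ℕ} [NeZero N] (hm : 1 ≤ m) (hn : 2 ≤ n) (hN : N + 2 = (m + 1) * (n + 1))
    {S : Set (Sym2 (ZMod N))} (hmax : MaxMRigid m S) (hconn : ConnectedSet S)
    (hnc : ∀ a ∈ S, ∀ b ∈ S, ¬ Crosses a b) {v : ZMod N} (hv : s(v, v + (m : ZMod N)) ∈ S) :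
    GoodTiles m S := by
  have hdv : (m + 1) ∣ N + 2 := ⟨_, hN⟩
  have hN3 : 3 * m + 1 ≤ N := by nlinarith
  have hall : ∀ d ∈ S, d = s(v, v + (m : ZMod N)) := by
    -- everything sharing a vertex with the short diagonal equals it
    have hsh : ∀ d ∈ S, (v ∈ d ∨ v + (m : ZMod N) ∈ d) → d = s(v, v + (m : ZMod N)) := by
      intro d hd h
      by_contra hne
      rcases h with h | h
      · exact rigid_nbr hmax.2.1 hnc hd hv hne hm le_rfl h (by simp)
      · exact rigid_nbr hmax.2.1 hnc hv hd (Ne.symm hne) hm le_rfl (v := v) (by simp) h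
    intro d hd
    obtain ⟨i, j, rfl⟩ : ∃ i j, d = s(i, j) := by
      induction d using Sym2.ind with | _ i j => exact ⟨i, j, rfl⟩
    have := conn_set hconn {x | x = v ∨ x = v + (m : ZMod N)} (by
      intro x y hxy hx
      have := hsh _ hxy (by
        rcases hx with rfl | rfl
        · left; simp
        · right; simp)
      have hy : y ∈ s(v, v + (m : ZMod N)) := this ▸ (by simp)
      exact Sym2.mem_iff.1 hy) hv (Or.inl rfl) hd
    refine hsh _ hd ?_
    rcases this with rfl | rfl
    · left; simp
    · right; simp
  have hn2 : n = 2 := by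
    by_contra hn'
    have hN4 : 4 * m + 2 ≤ N := by nlinarith [show 3 ≤ n by omega]
    have hmem : s(v + ((2 * m + 1 : ℕ) : ZMod N), v + ((3 * m + 1 : ℕ) : ZMod N)) ∈ S := by
      refine rigid_add (by omega) hmax ?_ ?_ ?_
      · refine (mdiag_iff hdv v (by omega) (by omega)).2 ⟨1, by omega⟩
      · intro e he hc
        rw [hall e he] at hc
        have h0 : v = v + ((0 : ℕ) : ZMod N) := by simp
        rw [show s(v, v + (m : ZMod N)) = s(v + ((0 : ℕ) : ZMod N), v + (m : ZMod N)) by simp] at hc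
        have := of_crosses v (by omega) (by omega) (by omega) (by omega) hc
        omega
      · intro e he x hx w hw k hk hkm
        rw [hall e he] at hw
        have hx' : ∃ i, (i = 2 * m + 1 ∨ i = 3 * m + 1) ∧ x = v + (i : ZMod N) := by
          rcases Sym2.mem_iff.1 hx with rfl | rfl
          · exact ⟨_, Or.inl rfl, rfl⟩
          · exact ⟨_, Or.inr rfl, rfl⟩
        have hw' : ∃ i : ℕ, (i = 0 ∨ i = m) ∧ w = v + (i : ZMod N) := by
          rcases Sym2.mem_iff.1 hw with rfl | rfl
          · exact ⟨0, Or.inl rfl, by simp⟩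
          · exact ⟨_, Or.inr rfl, rfl⟩
        obtain ⟨i, hi, rfl⟩ := hx'
        obtain ⟨j, hj, rfl⟩ := hw'
        refine far_ne (by omega) v (by omega) (by omega) ?_ hk hkm
        constructor <;> intro _ <;> omega
    have := hall _ hmem
    have h1 : v + ((2 * m + 1 : ℕ) : ZMod N) ∈ s(v, v + (m : ZMod N)) := this ▸ (by simp)
    rcases Sym2.mem_iff.1 h1 with h | h
    · have := coord_inj v (x := 2 * m + 1) (y := 0) (by omega) (by omega) (by simpa using h)
      omega
    · have := coord_inj v (x := 2 * m + 1) (y := m) (by omega) (by omega) h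
      omega
  subst hn2
  rintro T ⟨a, b, hab, rfl⟩
  have hS : ∀ d ∈ S, d = s(a, b) := fun d hd => (hall d hd).trans (hall _ hab).symm
  have hne : a ≠ b := fun h => (hmax.1 _ hab).1 (by simp [h])
  have hT : ∀ w, w ∈ tileAt S a b ↔ cnt a w ≤ cnt a b := by
    intro w
    constructor
    · exact fun h => h.1
    · exact fun h => ⟨h, fun c e hce hn => (hn (hS _ hce)).elim⟩
  have haT : a ∈ tileAt S a b := (hT a).2 (by simp [cnt])
  have hbT : b ∈ tileAt S a b := (hT b).2 le_rfl
  have hbd : IsBounding S (tileAt S a b) s(a, b) := by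
    refine ⟨hab, fun w hw => ?_⟩
    rcases Sym2.mem_iff.1 hw with rfl | rfl
    · exact haT
    · exact hbT
  have hlen : tileLen S (tileAt S a b) = 1 := by
    rw [tileLen, show {d | IsBounding S (tileAt S a b) d} = {s(a, b)} from ?_, Set.ncard_singleton]
    ext d
    exact ⟨fun h => hS d h.1, fun h => h ▸ hbd⟩
  have hob : IsOpenBdry S (tileAt S a b) a b := by
    refine ⟨hne, haT, hbT, ⟨_, hbd, by simp⟩, ⟨_, hbd, by simp⟩, ?_, ?_⟩
    · intro w hw
      refine ⟨(hT w).2 hw.2.le, fun d hd hwd => ?_⟩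
      rw [hS d hd] at hwd
      rcases Sym2.mem_iff.1 hwd with rfl | rfl
      · have := hw.1; simp [cnt] at this
      · exact absurd hw.2 (lt_irrefl _)
    · intro d hd hdn
      exact (hdn (hS d hd.1)).elim
  have hval : (m : ZMod N).val = m := ZMod.val_natCast_of_lt (by omega)
  rcases Sym2.eq_iff.1 (hall _ hab) with ⟨rfl, rfl⟩ | ⟨rfl, rfl⟩
  · left
    refine ⟨1, le_rfl, by omega, hlen, _, _, hob, ?_⟩
    simp [cnt, hval]
  · right; right; left
    refine ⟨hlen, _, _, hob, ?_⟩
    have := val_sub_add b (x := m) (y := 0) (by omega) (by omega)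
    simp only [Nat.cast_zero, add_zero] at this
    rw [cnt, this, if_neg (by omega)]
    omega

/-- Proposition 2.9. The possible tiles of a connected maximal `m`-rigid
set of `(m+1)`-diagonals of `P_{n,m}` are: `(k, m+k-1)` for `1 ≤ k ≤ m+1`; `(m+2, 2m+1)`
with at least one outer-diagonal short; `(1, 2m+1)`; `(m+3, m+1)` with both outer-diagonals
short; or `(m+3, 0)`. -/
theorem possible_tiles (m n N : ℕ) (hm : 1 ≤ m) (hn : 2 ≤ n)
    (hN : N = (m + 1) * (n + 1) - 2)
    (S : Set (Sym2 (ZMod N))) (hmax : MaxMRigid m S) (hconn : ConnectedSet S)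
    (hnc : ∀ a ∈ S, ∀ b ∈ S, ¬ Crosses a b) :
    GoodTiles m S := by
  have hN' : N + 2 = (m + 1) * (n + 1) := by
    have : 6 ≤ (m + 1) * (n + 1) := by nlinarith
    omega
  have hN3 : 3 * m + 1 ≤ N := by nlinarith
  haveI : NeZero N := ⟨by omega⟩
  by_cases h : ∃ d ∈ S, IsShort m d
  · obtain ⟨d, hd, v, rfl⟩ := h
    exact short_case hm hn hN' hmax hconn hnc hd
  · exact long_case hm (by omega) ⟨_, hN'⟩ hmax hconn hnc (fun d hd hs => h ⟨d, hd, hs⟩)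

end PaperTiling
end

section
/- Let S be a connected maximal m-rigid set of (m+1)-diagonals of P_{n,m} (hence pairwise noncrossing) and let T be a tile of S with an open boundary of length b. Then m ≤ b ≤ 2m+1. -/
namespace PaperTiling

variable {M : ℕ}

lemma val_sub_pos {N : ℕ} [NeZero N] (p u v : ZMod N) :
    ((u - p).val ≤ (v - p).val ∧ (v - u).val + (u - p).val = (v - p).val) ∨
    ((v - p).val < (u - p).val ∧ (v - u).val + (u - p).val = (v - p).val + N) := by
  have h : v - u = (v - p) - (u - p) := by ring
  have hu := ZMod.val_lt (u - p)
  have hv := ZMod.val_lt (v - p)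
  have h2 : (v - p) = (v - u) + (u - p) := by ring
  have hw := ZMod.val_lt (v - u)
  have h3 : (v - p).val = ((v - u).val + (u - p).val) % N := by
    conv_lhs => rw [h2]
    rw [ZMod.val_add]
  rcases lt_or_ge ((v - u).val + (u - p).val) N with h4 | h4
  · rw [Nat.mod_eq_of_lt h4] at h3
    left; omega
  · rw [Nat.mod_eq_sub_mod h4, Nat.mod_eq_of_lt (by omega)] at h3
    right; omega

lemma pos_add {N : ℕ} [NeZero N] (p u : ZMod N) (k : ℕ) (hk : k < N) :
    ((u + k - p).val = (u - p).val + k) ∨ ((u + k - p).val + N = (u - p).val + k) := by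
  have h := val_sub_pos p u (u + k)
  have h1 : (u + (k : ZMod N) - u).val = k := by
    rw [add_sub_cancel_left, ZMod.val_natCast, Nat.mod_eq_of_lt hk]
  omega

lemma pos_inj {N : ℕ} [NeZero N] (p u v : ZMod N) (h : (u - p).val = (v - p).val) : u = v := by
  have := ZMod.val_injective N h
  exact sub_left_injective this

lemma CW4 {N : ℕ} (a b c d : ZMod N) : CW [a, b, c, d] ↔
    ([a, b, c, d].Nodup ∧ (b - a).val + (c - b).val + (d - c).val + (a - d).val = N) := by
  simp [CW, add_assoc]

lemma CW4_rot {N : ℕ} {a b c d : ZMod N} (h : CW [a, b, c, d]) : CW [b, c, d, a] := by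
  rw [CW4] at *
  obtain ⟨h1, h2⟩ := h
  refine ⟨?_, by omega⟩
  have : [b, c, d, a] = [a, b, c, d].rotate 1 := rfl
  rw [this, List.nodup_rotate]; exact h1

lemma Crosses_symm {N : ℕ} {d e : Sym2 (ZMod N)} (h : Crosses d e) : Crosses e d := by
  obtain ⟨a1, b1, a2, b2, rfl, rfl, h⟩ := h
  exact ⟨b1, a2, b2, a1, rfl, Sym2.eq_swap, CW4_rot h⟩

lemma not_Crosses_self {N : ℕ} (d : Sym2 (ZMod N)) : ¬ Crosses d d := by
  rintro ⟨a1, b1, a2, b2, rfl, h, hc⟩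
  rw [CW4] at hc
  obtain ⟨h1, -⟩ := hc
  simp at h1
  rw [Sym2.eq_iff] at h
  tauto

lemma rigid_insert {N m : ℕ} {S : Set (Sym2 (ZMod N))} {d : Sym2 (ZMod N)}
    (hS : MRigid m S) (H1 : ∀ a ∈ S, ¬ Crosses a d)
    (H2 : ∀ a ∈ S, a ≠ d → ∀ v ∈ a, ∀ v' ∈ d, ∀ k : ℕ, 1 ≤ k → k ≤ m →
      v + (k : ZMod N) ≠ v' ∧ v' + (k : ZMod N) ≠ v)
    (H3 : ∀ k : ℕ, 1 ≤ k → k ≤ m → d ≠ shiftD k d) (hd : d ∉ S) : MRigid m (insert d S) := by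
  have hsh : ∀ a b : Sym2 (ZMod N), ∀ k : ℕ, b = shiftD k a →
      ∃ v ∈ a, v + (k : ZMod N) ∈ b := by
    rintro a b k rfl
    induction a using Sym2.ind with
    | _ x y => exact ⟨x, by simp, by simp [shiftD]⟩
  have hne : ∀ a ∈ S, a ≠ d := fun a ha h => hd (h ▸ ha)
  intro a ha b hb k hk hk' hE
  rcases ha with rfl | ha <;> rcases hb with rfl | hb
  · rcases hE with ⟨h, -⟩ | ⟨a1, b1, a2, b2, h1, h2, h3, -⟩ | h
    · exact h.1 rfl
    · exact not_Crosses_self _ ⟨a1, b1, a2, b2, h1, h2, h3⟩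
    · exact H3 k hk hk' h
  · have key : ¬ ∃ v ∈ a, v + (k : ZMod N) ∈ b := by
      rintro ⟨v, hv, hv'⟩
      exact (H2 b hb (hne b hb) _ hv' v hv k hk hk').2 rfl
    rcases hE with ⟨-, h⟩ | ⟨a1, b1, a2, b2, h1, h2, h3, -⟩ | h
    · exact key h
    · exact H1 b hb (Crosses_symm ⟨a1, b1, a2, b2, h1, h2, h3⟩)
    · exact key (hsh _ _ _ h)
  · have key : ¬ ∃ v ∈ a, v + (k : ZMod N) ∈ b := by
      rintro ⟨v, hv, hv'⟩
      exact (H2 a ha (hne a ha) v hv _ hv' k hk hk').1 rfl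
    rcases hE with ⟨-, h⟩ | ⟨a1, b1, a2, b2, h1, h2, h3, -⟩ | h
    · exact key h
    · exact H1 a ha ⟨a1, b1, a2, b2, h1, h2, h3⟩
    · exact key (hsh _ _ _ h)
  · exact hS a ha b hb k hk hk' hE

/-- Two distinct diagonals of a rigid noncrossing set have no endpoints at distance `1,…,m`. -/
lemma rigid_far {N m : ℕ} {S : Set (Sym2 (ZMod N))} (hS : MRigid m S)
    (hnc : ∀ a ∈ S, ∀ b ∈ S, ¬ Crosses a b) {a b : Sym2 (ZMod N)} (ha : a ∈ S) (hb : b ∈ S)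
    (hab : a ≠ b) {v : ZMod N} {k : ℕ} (hk : 1 ≤ k) (hk' : k ≤ m) (hv : v ∈ a) :
    v + (k : ZMod N) ∉ b := fun h =>
  hS a ha b hb k hk hk' (Or.inl ⟨⟨hab, hnc a ha b hb, v, hv, Or.inl h⟩, v, hv, h⟩)

lemma isMDiag_of {N m : ℕ} [NeZero N] (hdvd : (m + 1) ∣ N + 2) {x w : ZMod N} (hne : x ≠ w)
    (h : (m + 1) ∣ cnt x w) : IsMDiag m s(x, w) := by
  refine ⟨by simpa using hne, ?_⟩
  intro i j hij
  rw [Sym2.eq_iff] at hij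
  rcases hij with ⟨rfl, rfl⟩ | ⟨rfl, rfl⟩
  · exact h
  · have h1 := val_sub_pos x w x
    have h0 : (w - x).val ≠ 0 := by
      rw [Ne, ZMod.val_eq_zero, sub_eq_zero]; exact fun h => hne h.symm
    simp only [sub_self, ZMod.val_zero] at h1
    have : cnt w x = N + 2 - cnt x w := by unfold cnt; omega
    rw [this]
    exact Nat.dvd_sub hdvd h

/-- Claim 1 in Proposition 2.9. For a tile of a connected maximal
`m`-rigid set with an open boundary of length `b`, one has `m ≤ b ≤ 2m+1`. -/
theorem open_boundary_length (m n N : ℕ) (hm : 1 ≤ m) (hn : 2 ≤ n)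
    (hN : N = (m + 1) * (n + 1) - 2)
    (S : Set (Sym2 (ZMod N))) (hmax : MaxMRigid m S) (hconn : ConnectedSet S)
    (hnc : ∀ a ∈ S, ∀ b ∈ S, ¬ Crosses a b)
    (T : Set (ZMod N)) (hT : IsTile S T) (p q : ZMod N) (hb : IsOpenBdry S T p q) :
    m ≤ cnt p q - 1 ∧ cnt p q - 1 ≤ 2 * m + 1 := by
  have hbig : (m + 1) * 3 ≤ (m + 1) * (n + 1) := Nat.mul_le_mul_left _ (by omega)
  have hN3 : 3 * m + 1 ≤ N := by omega
  have hdvd : (m + 1) ∣ N + 2 := ⟨n + 1, by omega⟩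
  haveI : NeZero N := ⟨by omega⟩
  obtain ⟨hdiag, hrig, hmx⟩ := hmax
  obtain ⟨hpq, -, -, ⟨dp, ⟨hdp, -⟩, hpdp⟩, ⟨dq, ⟨hdq, -⟩, hqdq⟩, hin, -⟩ := hb
  obtain ⟨b, hbdef⟩ : ∃ b, b = (q - p).val := ⟨_, rfl⟩
  have hcnt : cnt p q - 1 = b := by simp [cnt, hbdef]
  rw [hcnt]
  have hbN : b < N := hbdef ▸ ZMod.val_lt _
  have hb0 : 1 ≤ b := by
    rw [hbdef, Nat.one_le_iff_ne_zero, Ne, ZMod.val_eq_zero, sub_eq_zero]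
    exact fun h => hpq h.symm
  have hpp : (p - p).val = 0 := by simp
  have hqb : q = p + (b : ZMod N) := by
    rw [hbdef, ZMod.natCast_zmod_val]; ring
  -- positions of non-isolated vertices
  have hpos : ∀ a ∈ S, ∀ v ∈ a, (v - p).val = 0 ∨ b ≤ (v - p).val := by
    intro a ha v hv
    by_contra hcon
    push Not at hcon
    exact (hin v ⟨by unfold cnt; omega, by unfold cnt; omega⟩).2 a ha hv
  constructor
  · by_contra hlt
    push Not at hlt
    by_cases hd : dp = dq
    · subst hd
      have : dp = s(p, q) := ((Sym2.mem_and_mem_iff hpq).1 ⟨hpdp, hqdq⟩)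
      have h := Nat.le_of_dvd (by simp [cnt]) ((hdiag dp hdp).2 p q this)
      unfold cnt at h; omega
    · exact rigid_far hrig hnc hdp hdq hd hb0 hlt.le hpdp (hqb ▸ hqdq)
  · by_contra hgt
    push Not at hgt
    have hcross : ∀ (x w : ZMod N), (∀ c e : ZMod N, s(c, e) ∈ S → ¬ CW [x, c, w, e]) →
        ∀ a ∈ S, ¬ Crosses a s(x, w) := by
      intro x w h a ha hc
      obtain ⟨a1, b1, a2, b2, h1, rfl, h3⟩ := Crosses_symm hc
      rw [Sym2.eq_iff] at h1
      rcases h1 with ⟨rfl, rfl⟩ | ⟨rfl, rfl⟩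
      · exact h _ _ ha h3
      · exact h _ _ (by rw [Sym2.eq_swap]; exact ha) (CW4_rot (CW4_rot h3))
    -- adding a short diagonal
    have hb3 : b < 3 * m + 2 := by
      by_contra hb3
      push Not at hb3
      have hu := pos_add p p (m + 1) (by omega)
      have hw := pos_add p p (2 * m + 1) (by omega)
      set u : ZMod N := p + ((m + 1 : ℕ) : ZMod N)
      set w : ZMod N := p + ((2 * m + 1 : ℕ) : ZMod N)
      have huw := val_sub_pos p u w
      have hwN := ZMod.val_lt (w - p)
      have huN := ZMod.val_lt (u - p)
      have hne : u ≠ w := by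
        intro h; rw [h] at hu; omega
      have hnS : s(u, w) ∉ S := by
        intro h
        have := hpos _ h u (by simp)
        omega
      refine hmx s(u, w) (isMDiag_of hdvd hne ?_) hnS (rigid_insert hrig ?_ ?_ ?_ hnS)
      · have : cnt u w = m + 1 := by unfold cnt; omega
        rw [this]
      · apply hcross
        intro c e hce hcw
        rw [CW4] at hcw
        obtain ⟨hnd, hsum⟩ := hcw
        have hc := hpos _ hce c (by simp)
        have he := hpos _ hce e (by simp)
        have h1 := val_sub_pos p u c
        have h2 := val_sub_pos p c w
        have h3 := val_sub_pos p w e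
        have h4 := val_sub_pos p e u
        have := ZMod.val_lt (c - p)
        have := ZMod.val_lt (e - p)
        omega
      · intro a ha _ v hv v' hv' k hk hk'
        have h1 := hpos _ ha v hv
        have h2 := pos_add p v k (by omega)
        have h3 := pos_add p v' k (by omega)
        have h4 := ZMod.val_lt (v - p)
        have hv'' : (v' - p).val = m + 1 ∨ (v' - p).val = 2 * m + 1 := by
          rw [Sym2.mem_iff] at hv'
          rcases hv' with rfl | rfl <;> omega
        constructor
        · intro h; rw [h] at h2; omega
        · intro h; rw [h] at h3; omega
      · intro k hk hk' h
        have : u ∈ shiftD k s(u, w) := h ▸ (by simp)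
        have h2 := pos_add p u k (by omega)
        have h3 := pos_add p w k (by omega)
        simp only [shiftD, Sym2.map_mk, Sym2.mem_iff] at this
        rcases this with h | h
        · rw [← h] at h2; omega
        · rw [← h] at h3; omega
    -- the diagonal at `p` closest to `q`
    obtain ⟨x, hxS, hxmin⟩ : ∃ x, s(p, x) ∈ S ∧
        ∀ y, s(p, y) ∈ S → (x - p).val ≤ (y - p).val := by
      obtain ⟨y, rfl⟩ := hpdp
      exact (Set.exists_min_image {y : ZMod N | s(p, y) ∈ S} (fun y => (y - p).val)
        (Set.toFinite _) ⟨y, hdp⟩)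
    have hxp : x ≠ p := by
      rintro rfl
      exact (hdiag _ hxS).1 (by simp)
    have hX0 : (x - p).val ≠ 0 := by
      rw [Ne, ZMod.val_eq_zero, sub_eq_zero]; exact hxp
    have hX := (hpos _ hxS x (by simp)).resolve_left hX0
    have hXN := ZMod.val_lt (x - p)
    have hxpv := val_sub_pos p x p
    by_cases hshort : x + (m : ZMod N) = p
    · -- short case
      have hXm : (x - p).val = N - m := by
        have := pos_add p x m (by omega)
        rw [hshort] at this
        omega
      have hclosed : ∀ a ∈ S, (p ∈ a ∨ x ∈ a) → a = s(p, x) := by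
        intro a ha h
        by_contra hne
        rcases h with h | h
        · exact rigid_far hrig hnc hxS ha (Ne.symm hne) hm le_rfl (v := x) (by simp)
            (by rw [hshort]; exact h)
        · exact rigid_far hrig hnc ha hxS hne hm le_rfl h (by rw [hshort]; simp)
      have hpi : ¬ Isolated S p := fun h => h _ hxS (by simp)
      have hqi : ¬ Isolated S q := fun h => h _ hdq hqdq
      have hwalk : ∀ (y z : {v : ZMod N | ¬ Isolated S v})
          (W : ((graphOf S).induce {v : ZMod N | ¬ Isolated S v}).Walk y z),
          (y.1 = p ∨ y.1 = x) → (z.1 = p ∨ z.1 = x) := by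
        intro y z W
        induction W with
        | nil => exact id
        | cons hadj _ ih =>
          intro h
          apply ih
          have hadj' := hadj
          simp only [SimpleGraph.comap_adj, graphOf, SimpleGraph.fromEdgeSet_adj,
            Function.Embedding.subtype_apply] at hadj'
          have := hclosed _ hadj'.1 (by
            rcases h with h | h
            · left; rw [← h]; simp
            · right; rw [← h]; simp)
          rw [Sym2.eq_iff] at this
          tauto
      obtain ⟨W⟩ := hconn.preconnected ⟨p, hpi⟩ ⟨q, hqi⟩
      have hqx : q = x := (hwalk _ _ W (Or.inl rfl)).resolve_left (fun h => hpq h.symm)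
      rw [hqx] at hbdef
      obtain ⟨c, hc⟩ := hdvd
      have : 3 < c := by
        by_contra hc3
        have := Nat.mul_le_mul_left (m + 1) (show c ≤ 3 by omega)
        omega
      have := Nat.mul_le_mul_left (m + 1) (show 4 ≤ c by omega)
      omega
    · have hw := pos_add p p (m + 1) (by omega)
      set w : ZMod N := p + ((m + 1 : ℕ) : ZMod N)
      have hwN := ZMod.val_lt (w - p)
      have hwv : (w - p).val = m + 1 := by omega
      have hxw := val_sub_pos p x w
      have hne : x ≠ w := by
        intro h; rw [h] at hX; omega
      have hfar : ∀ a ∈ S, ∀ v ∈ a, ∀ k : ℕ, 1 ≤ k → k ≤ m →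
          v + (k : ZMod N) ≠ w ∧ w + (k : ZMod N) ≠ v := by
        intro a ha v hv k hk hk'
        have h1 := hpos _ ha v hv
        have h2 := pos_add p v k (by omega)
        have h3 := pos_add p w k (by omega)
        have h4 := ZMod.val_lt (v - p)
        constructor
        · intro h; rw [h] at h2; omega
        · intro h; rw [h] at h3; omega
      have hnS : s(x, w) ∉ S := by
        intro h
        have := hpos _ h w (by simp)
        omega
      refine hmx s(x, w) (isMDiag_of hdvd hne ?_) hnS (rigid_insert hrig ?_ ?_ ?_ hnS)
      · have h1 := (hdiag _ hxS).2 x p Sym2.eq_swap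
        have : cnt x w = cnt x p + (m + 1) := by unfold cnt; omega
        rw [this]
        exact Nat.dvd_add h1 dvd_rfl
      · apply hcross
        intro c e hce hcw
        rw [CW4] at hcw
        obtain ⟨hnd, hsum⟩ := hcw
        have hc := hpos _ hce c (by simp)
        have he := hpos _ hce e (by simp)
        have h1 := val_sub_pos p x c
        have h2 := val_sub_pos p c w
        have h3 := val_sub_pos p w e
        have h4 := val_sub_pos p e x
        have h5 := ZMod.val_lt (c - p)
        have h6 := ZMod.val_lt (e - p)
        simp only [List.nodup_cons, List.mem_cons, not_or, List.not_mem_nil] at hnd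
        have hcx : (x - p).val ≠ (c - p).val := fun h => hnd.1.1 (pos_inj p _ _ h)
        have hex : (x - p).val ≠ (e - p).val := fun h => hnd.1.2.2.1 (pos_inj p _ _ h)
        have hec : (c - p).val ≠ (e - p).val := fun h => hnd.2.1.2.1 (pos_inj p _ _ h)
        by_cases hcp : c = p
        · subst hcp
          have := hxmin e hce
          omega
        · have hc0 : (c - p).val ≠ 0 := by
            rw [Ne, ZMod.val_eq_zero, sub_eq_zero]; exact hcp
          by_cases hep : e = p
          · subst hep
            omega
          · have he0 : (e - p).val ≠ 0 := by
              rw [Ne, ZMod.val_eq_zero, sub_eq_zero]; exact hep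
            refine hnc _ hxS _ hce (Crosses_symm ⟨c, p, e, x, rfl, rfl, ?_⟩)
            rw [CW4]
            have h7 := val_sub_pos p c p
            have h8 := val_sub_pos p x c
            refine ⟨?_, by omega⟩
            have e1 := Ne.symm hep
            have e2 := Ne.symm hxp
            have e3 : c ≠ x := fun h => hnd.1.1 h.symm
            have e4 : e ≠ x := fun h => hnd.1.2.2.1 h.symm
            have e5 := hnd.2.1.2.1
            clear * - e1 e2 e3 e4 e5 hcp
            simp only [List.nodup_cons, List.mem_cons, not_or, List.not_mem_nil]
            simp [e1, e2, e3, e4, e5, hcp]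
      · intro a ha _ v hv v' hv' k hk hk'
        rw [Sym2.mem_iff] at hv'
        rcases hv' with rfl | rfl
        · by_cases hap : a = s(p, v')
          · rw [hap, Sym2.mem_iff] at hv
            have h2 := pos_add p v k (by omega)
            have h3 := pos_add p v' k (by omega)
            rcases hv with rfl | rfl
            · constructor
              · intro h; rw [h] at h2; omega
              · intro h
                have h1 := Nat.le_of_dvd (by simp [cnt])
                  ((hdiag _ hxS).2 v' v Sym2.eq_swap)
                have h4 : k = m := by
                  rw [h] at h3; unfold cnt at h1; omega
                rw [h4] at h
                exact hshort h
            · constructor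
              · intro h; rw [h] at h2; omega
              · intro h; rw [h] at h2; omega
          · constructor
            · intro h
              exact rigid_far hrig hnc ha hxS hap hk hk' hv (by rw [h]; simp)
            · intro h
              exact rigid_far hrig hnc hxS ha (Ne.symm hap) hk hk' (v := v') (by simp)
                (by rw [h]; exact hv)
        · exact hfar a ha v hv k hk hk'
      · intro k hk hk' h
        have : w ∈ shiftD k s(x, w) := h ▸ (by simp)
        simp only [shiftD, Sym2.map_mk, Sym2.mem_iff] at this
        rcases this with h | h
        · exact (hfar _ hxS x (by simp) k hk hk').1 h.symm
        · have h2 := pos_add p w k (by omega)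
          rw [← h] at h2; omega
end PaperTiling
end
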